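/- arXiv:1406.0107 — 2 statements merged into one kernel-verified Lean document; each statement's English description precedes it below -/
import Mathlib

section
/- Let q be an odd prime power, d ≥ 2, and E ⊆ 𝔽_q^d. For x ∈ 𝔽_q^d let h(x) = |{y ∈ E : ‖x − y‖ = 1}| and let H_n = |{x ∈ E : h(x) ≥ n}|. If |E| ≥ (4/ln 2)·q^{(d+1)/2}, then H_n ≥ |E| − 10·q^{(d+1)/2} − 2qn. -/
namespace Kl

/-- Monomial of weight `w`. -/
def M {R : Type*} [CommRing R] (q : ℕ) (X Y : R) (w : ℕ) : R := X ^ (w / q) * Y ^ (w % q)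

/-- Span of the monomials of weight in `[q, m]`. -/
def V (L : Type*) {R : Type*} [Field L] [CommRing R] [Algebra L R] (q : ℕ) (X Y : R) (m : ℕ) :
    Submodule L R := Submodule.span L (M q X Y '' Set.Icc q m)

section ring
variable {L R : Type*} [Field L] [CommRing R] [Algebra L R] {q : ℕ} {X Y : R}

lemma V_mono {m m' : ℕ} (h : m ≤ m') : V L q X Y m ≤ V L q X Y m' :=
  Submodule.span_mono (Set.image_mono (Set.Icc_subset_Icc_right h))

lemma mono_mem (i j m : ℕ) (hi : 1 ≤ i) (hj : j < q) (hm : q * i + j ≤ m) :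
    X ^ i * Y ^ j ∈ V L q X Y m := by
  refine Submodule.subset_span ⟨q * i + j, ⟨?_, hm⟩, ?_⟩
  · nlinarith
  · have h1 : (q * i + j) / q = i := by
      rw [Nat.mul_add_div (by omega), Nat.div_eq_of_lt hj, add_zero]
    have h2 : (q * i + j) % q = j := by
      rw [Nat.mul_add_mod, Nat.mod_eq_of_lt hj]
    simp [M, h1, h2]

lemma M_mul_mem (hq : 2 ≤ q) {b c : L}
    (rel : X * Y ^ q = X * Y + X ^ 2 + algebraMap L R b - algebraMap L R c * X)
    {w w' : ℕ} (hw : q ≤ w) (hw' : q ≤ w') :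
    M q X Y w * M q X Y w' ∈ V L q X Y (w + w') := by
  have e1 := Nat.div_add_mod w q
  have e2 := Nat.div_add_mod w' q
  have l1 := Nat.mod_lt w (by omega : q > 0)
  have l2 := Nat.mod_lt w' (by omega : q > 0)
  have g1 : 1 ≤ w / q := (Nat.one_le_div_iff (by omega)).2 hw
  have g2 : 1 ≤ w' / q := (Nat.one_le_div_iff (by omega)).2 hw'
  unfold M
  generalize w / q = i at *
  generalize w' / q = i' at *
  generalize w % q = j at *
  generalize w' % q = j' at *
  subst e1 e2
  by_cases h : j + j' < q
  · have : X ^ i * Y ^ j * (X ^ i' * Y ^ j') = X ^ (i + i') * Y ^ (j + j') := by ring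
    rw [this]
    exact mono_mem _ _ _ (by omega) h (by rw [mul_add]; omega)
  · obtain ⟨r, hr⟩ : ∃ r, j + j' = q + r := ⟨j + j' - q, by omega⟩
    obtain ⟨I, hI⟩ : ∃ I, i + i' = I + 2 := ⟨i + i' - 2, by omega⟩
    have : X ^ i * Y ^ j * (X ^ i' * Y ^ j') =
        X ^ (I + 3) * Y ^ r + X ^ (I + 2) * Y ^ (r + 1) + b • (X ^ (I + 1) * Y ^ r)
          - c • (X ^ (I + 2) * Y ^ r) := by
      calc X ^ i * Y ^ j * (X ^ i' * Y ^ j') = X ^ (i + i') * Y ^ (j + j') := by ring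
        _ = X ^ (I + 1) * Y ^ r * (X * Y ^ q) := by rw [hr, hI]; ring
        _ = _ := by rw [rel, Algebra.smul_def, Algebra.smul_def]; ring
    rw [this]
    have e : q * i + j + (q * i' + j') = q * I + 2 * q + q + r := by
      have : q * i + q * i' = q * I + 2 * q := by rw [← mul_add, hI]; ring
      omega
    rw [e]
    refine sub_mem (add_mem (add_mem ?_ ?_) (Submodule.smul_mem _ _ ?_)) (Submodule.smul_mem _ _ ?_)
    · exact mono_mem _ _ _ (by omega) (by omega) (by ring_nf; omega)
    · exact mono_mem _ _ _ (by omega) (by omega) (by ring_nf; omega)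
    · exact mono_mem _ _ _ (by omega) (by omega) (by ring_nf; omega)
    · exact mono_mem _ _ _ (by omega) (by omega) (by ring_nf; omega)

open scoped Pointwise in
lemma V_mul (hq : 2 ≤ q) {b c : L}
    (rel : X * Y ^ q = X * Y + X ^ 2 + algebraMap L R b - algebraMap L R c * X)
    {m m' : ℕ} {f g : R} (hf : f ∈ V L q X Y m) (hg : g ∈ V L q X Y m') :
    f * g ∈ V L q X Y (m + m') := by
  have h : f * g ∈ Submodule.span L ((M q X Y '' Set.Icc q m) * (M q X Y '' Set.Icc q m')) := by
    rw [← Submodule.span_mul_span]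
    exact Submodule.mul_mem_mul hf hg
  refine Submodule.span_le.2 ?_ h
  rintro _ ⟨_, ⟨w, hw, rfl⟩, _, ⟨w', hw', rfl⟩, rfl⟩
  exact V_mono (by have := hw.2; have := hw'.2; omega) (M_mul_mem hq rel hw.1 hw'.1)

lemma V_pow (hq : 2 ≤ q) {b c : L}
    (rel : X * Y ^ q = X * Y + X ^ 2 + algebraMap L R b - algebraMap L R c * X)
    {m : ℕ} {f : R} (hf : f ∈ V L q X Y m) (n : ℕ) :
    f ^ (n + 1) ∈ V L q X Y ((n + 1) * m) := by
  induction n with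
  | zero => simpa using hf
  | succ n ih => rw [pow_succ, add_mul (n + 1) 1, one_mul]; exact V_mul hq rel ih hf

lemma M_mem {w m : ℕ} (h1 : q ≤ w) (h2 : w ≤ m) : M q X Y w ∈ V L q X Y m :=
  Submodule.subset_span ⟨w, ⟨h1, h2⟩, rfl⟩

instance (m : ℕ) : Module.Finite L (V L q X Y m) :=
  Module.Finite.span_of_finite L ((Set.finite_Icc q m).image _)

variable {K : Type*} [Field K] [Algebra L K] (gen : R →ₐ[L] K)

/-- The independence assumption on the generic point. -/
def Indep (L : Type*) {R K : Type*} [Field L] [CommRing R] [Algebra L R] [Field K] [Algebra L K]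
    (gen : R →ₐ[L] K) (q : ℕ) (X Y : R) : Prop :=
  LinearIndependent L (fun w : ℕ => gen (M q X Y (q + w)))

variable {gen}

lemma finrank_V (hI : Indep L gen q X Y) (m : ℕ) :
    Module.finrank L (V L q X Y m) = m + 1 - q := by
  have h1 : LinearIndependent L (fun w : ℕ => M q X Y (q + w)) :=
    LinearIndependent.of_comp gen.toLinearMap hI
  have h2 : LinearIndependent L (fun w : Fin (m + 1 - q) => M q X Y (q + w)) :=
    h1.comp _ Fin.val_injective
  have := finrank_span_eq_card h2
  rw [Fintype.card_fin] at this
  have e : M q X Y '' Set.Icc q m = Set.range (fun w : Fin (m + 1 - q) => M q X Y (q + w)) := by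
    ext r
    constructor
    · rintro ⟨w, ⟨h1, h2⟩, rfl⟩
      exact ⟨⟨w - q, by omega⟩, by simp only; congr 1; omega⟩
    · rintro ⟨w, rfl⟩
      exact ⟨q + w, ⟨by omega, by have := w.2; omega⟩, rfl⟩
  rw [V, e, this]

lemma gen_inj (hI : Indep L gen q X Y) {m : ℕ} {f : R} (hf : f ∈ V L q X Y m) (h : gen f = 0) :
    f = 0 := by
  have hf' : f ∈ Submodule.span L (Set.range (fun w : ℕ => M q X Y (q + w))) := by
    refine Submodule.span_mono ?_ hf
    rintro _ ⟨w, ⟨h1, h2⟩, rfl⟩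
    exact ⟨w - q, by simp only; congr 1; omega⟩
  rw [Finsupp.mem_span_range_iff_exists_finsupp] at hf'
  obtain ⟨c, rfl⟩ := hf'
  have : c = 0 := by
    refine (linearIndependent_iff.1 hI) c ?_
    rw [← h, Finsupp.linearCombination_apply, Finsupp.sum, Finsupp.sum, map_sum]
    simp
  subst this
  simp

lemma zero_count (hq : 2 ≤ q) {b c : L}
    (rel : X * Y ^ q = X * Y + X ^ 2 + algebraMap L R b - algebraMap L R c * X)
    (hI : Indep L gen q X Y) {P : Type*} [Fintype P] (ev : P → (R →ₐ[L] L))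
    (hX : ∀ p, ev p X ≠ 0) (hinj : ∀ p p', ev p X = ev p' X → ev p Y = ev p' Y → p = p')
    {D : ℕ} {G : R} (hG : G ∈ V L q X Y D) (hG0 : gen G ≠ 0) (hz : ∀ p, ev p G = 0) :
    Fintype.card P ≤ D := by
  classical
  have hXm : X ∈ V L q X Y q := by
    simpa using mono_mem (L := L) (X := X) (Y := Y) 1 0 q le_rfl (by omega) (by omega)
  -- separation
  have sep : ∀ p p', p ≠ p' → ∃ r ∈ V L q X Y (3 * q), ev p r ≠ 0 ∧ ev p' r = 0 := by
    intro p p' hpp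
    by_cases hx : ev p X = ev p' X
    · refine ⟨X ^ 1 * Y ^ 1 - (ev p' Y) • (X ^ 1 * Y ^ 0),
        sub_mem (mono_mem _ _ _ le_rfl (by omega) (by omega))
          (Submodule.smul_mem _ _ (mono_mem _ _ _ le_rfl (by omega) (by omega))), ?_, ?_⟩
      · simp only [map_sub, map_mul, map_pow, map_smul, smul_eq_mul]
        intro h
        have : ev p X * (ev p Y - ev p' Y) = 0 := by rw [← h]; ring
        rcases mul_eq_zero.1 this with h | h
        · exact hX p h
        · exact hpp (hinj _ _ hx (sub_eq_zero.1 h))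
      · simp only [map_sub, map_mul, map_pow, map_smul, smul_eq_mul]; ring
    · refine ⟨X ^ 2 * Y ^ 0 - (ev p' X) • (X ^ 1 * Y ^ 0),
        sub_mem (mono_mem _ _ _ (by omega) (by omega) (by omega))
          (Submodule.smul_mem _ _ (mono_mem _ _ _ le_rfl (by omega) (by omega))), ?_, ?_⟩
      · simp only [map_sub, map_mul, map_pow, map_smul, smul_eq_mul]
        intro h
        have : ev p X * (ev p X - ev p' X) = 0 := by rw [← h]; ring
        rcases mul_eq_zero.1 this with h | h
        · exact hX p h
        · exact hx (sub_eq_zero.1 h)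
      · simp only [map_sub, map_mul, map_pow, map_smul, smul_eq_mul]; ring
  have sep2 : ∀ p, ∀ T : Finset P, p ∉ T →
      ∃ m, ∃ r ∈ V L q X Y m, ev p r ≠ 0 ∧ ∀ p' ∈ T, ev p' r = 0 := by
    intro p T
    induction T using Finset.induction_on with
    | empty => intro _; exact ⟨q, X, hXm, hX p, by simp⟩
    | insert a T ha ih =>
      intro hp
      simp only [Finset.mem_insert, not_or] at hp
      obtain ⟨m, r, hr, h1, h2⟩ := ih hp.2
      obtain ⟨s, hs, h3, h4⟩ := sep p a hp.1
      refine ⟨m + 3 * q, r * s, V_mul hq rel hr hs, by simp [h1, h3], ?_⟩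
      intro p' hp'
      rcases Finset.mem_insert.1 hp' with rfl | hp'
      · simp [h4]
      · simp [h2 p' hp']
  have sep3 : ∀ p, ∃ m, ∃ r ∈ V L q X Y m, ∀ p', ev p' r = if p' = p then 1 else 0 := by
    intro p
    obtain ⟨m, r, hr, h1, h2⟩ := sep2 p (Finset.univ.erase p) (by simp)
    refine ⟨m, (ev p r)⁻¹ • r, Submodule.smul_mem _ _ hr, ?_⟩
    intro p'
    split_ifs with h
    · subst h; simp [h1]
    · simp [h2 p' (by simp [h])]
  choose mm r hr hr' using sep3
  set m := (∑ p, mm p) + q with hm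
  have hmm : ∀ p, mm p ≤ m := fun p =>
    (Finset.single_le_sum (fun _ _ => Nat.zero_le _) (Finset.mem_univ p)).trans (by omega)
  let ε : R →ₗ[L] (P → L) := LinearMap.pi (fun p => (ev p).toLinearMap)
  let ε' : V L q X Y (m + D) →ₗ[L] (P → L) := ε ∘ₗ (V L q X Y (m + D)).subtype
  have hsurj : Function.Surjective ε' := by
    intro g
    refine ⟨⟨∑ p, g p • r p, Submodule.sum_mem _ fun p _ => Submodule.smul_mem _ _
      (V_mono ((hmm p).trans (by omega)) (hr p))⟩, ?_⟩
    ext p'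
    simp [ε', ε, hr']
  have h1 := LinearMap.finrank_range_add_finrank_ker ε'
  rw [LinearMap.range_eq_top.2 hsurj, finrank_top, Module.finrank_pi] at h1
  let μ : V L q X Y m →ₗ[L] LinearMap.ker ε' :=
    LinearMap.codRestrict _ (LinearMap.codRestrict _
      ((LinearMap.mulRight L G) ∘ₗ (V L q X Y m).subtype)
      (fun f => by simpa using V_mul hq rel f.2 hG))
      (fun f => by
        rw [LinearMap.mem_ker]; ext p; simp [ε', ε, hz])
  have hμ : Function.Injective μ := by
    rw [injective_iff_map_eq_zero]
    intro f hf
    have : (f : R) * G = 0 := by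
      have := congrArg (fun z : LinearMap.ker ε' => ((z : V L q X Y (m + D)) : R)) hf
      simpa [μ] using this
    have h2 : gen (f : R) = 0 := by
      have h3 : gen (f : R) * gen G = 0 := by rw [← map_mul, this, map_zero]
      exact (mul_eq_zero.1 h3).resolve_right hG0
    exact Subtype.ext (gen_inj hI f.2 h2)
  have h2 := LinearMap.finrank_le_finrank_of_injective hμ
  rw [finrank_V hI] at h1 h2
  omega

end ring
end Kl
namespace Kl
section generic

lemma val_indep {L K Γ : Type*} [Field L] [Field K] [Algebra L K]
    [LinearOrderedCommGroupWithZero Γ] (v : Valuation K Γ)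
    (hv : ∀ a : L, a ≠ 0 → v (algebraMap L K a) = 1) {ι : Type*} (f : ι → K)
    (hf : ∀ i, v (f i) ≠ 0) (hinj : Function.Injective (fun i => v (f i))) :
    LinearIndependent L f := by
  classical
  rw [linearIndependent_iff']
  intro s g hg
  by_contra! hcon
  obtain ⟨i0, hi0, hgi0⟩ := hcon
  set t := s.filter (fun i => g i ≠ 0) with ht
  have hs : ∑ i ∈ t, g i • f i = 0 := by
    rw [← hg, ht, Finset.sum_filter]
    refine Finset.sum_congr rfl fun i _ => ?_
    split_ifs with h
    · rfl
    · push Not at h; simp [h]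
  have hne : t.Nonempty := ⟨i0, by simp [ht, hi0, hgi0]⟩
  obtain ⟨i, hi, hmax⟩ := t.exists_max_image (fun i => v (f i)) hne
  have hvi : ∀ j ∈ t, v (g j • f j) = v (f j) := by
    intro j hj
    rw [Algebra.smul_def, map_mul, hv _ (Finset.mem_filter.1 hj).2, one_mul]
  rw [← Finset.add_sum_erase _ _ hi] at hs
  have h1 : v (∑ x ∈ t.erase i, g x • f x) < v (g i • f i) := by
    refine Valuation.map_sum_lt _ (by rw [hvi i hi]; exact hf i) ?_
    intro j hj
    have hj' := Finset.mem_of_mem_erase hj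
    rw [hvi i hi, hvi j hj']
    refine lt_of_le_of_ne (hmax j hj') fun h => Finset.ne_of_mem_erase hj (hinj h)
  have h2 : g i • f i = - ∑ x ∈ t.erase i, g x • f x := eq_neg_of_add_eq_zero_left hs
  rw [h2, Valuation.map_neg] at h1
  exact lt_irrefl _ h1

open Polynomial in
lemma exists_val (L : Type) [Field L] :
    ∃ (K : Type) (_ : Field K) (_ : Algebra L K) (_ : IsAlgClosed K) (Γ : Type)
      (_ : LinearOrderedCommGroupWithZero Γ) (v : Valuation K Γ) (x : K),
      (∀ a : L, a ≠ 0 → v (algebraMap L K a) = 1) ∧ 1 < v x := by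
  let K := AlgebraicClosure (RatFunc L)
  let φ : L[X] →ₐ[L] K := (Algebra.ofId (RatFunc L) K).restrictScalars L |>.comp
    (Algebra.algHom L L[X] (RatFunc L))
  have hφ : Function.Injective φ := by
    intro a b h
    have h' : algebraMap (RatFunc L) K (algebraMap L[X] (RatFunc L) a) =
        algebraMap (RatFunc L) K (algebraMap L[X] (RatFunc L) b) := h
    exact IsFractionRing.injective L[X] (RatFunc L) ((algebraMap (RatFunc L) K).injective h')
  let A : Subring K := φ.toRingHom.range
  let t : A := ⟨φ X, ⟨X, rfl⟩⟩
  have hI : Ideal.span {t} ≠ ⊤ := by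
    rw [Ne, Ideal.span_singleton_eq_top]
    intro hu
    obtain ⟨⟨_, ⟨p, rfl⟩⟩, hs⟩ := hu.exists_right_inv
    have : φ X * φ p = φ 1 := by simpa using congrArg Subtype.val hs
    rw [← map_mul] at this
    have := hφ this
    have := congrArg (eval 0) this
    simp at this
  obtain ⟨B, hAB, hB⟩ := Ideal.image_subset_nonunits_valuationSubring _ hI
  have hmem : ∀ a : L, algebraMap L K a ∈ B := fun a => hAB ⟨C a, by
    have : φ (C a) = algebraMap L K a := by
      rw [← Polynomial.algebraMap_eq, AlgHom.commutes]
    exact this⟩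
  refine ⟨K, inferInstance, inferInstance, inferInstance, B.ValueGroup, inferInstance,
    B.valuation, (φ X)⁻¹, ?_, ?_⟩
  · intro a ha
    refine le_antisymm ((B.valuation_le_one_iff _).2 (hmem a)) ?_
    have := (B.valuation_le_one_iff _).2 (hmem a⁻¹)
    rw [map_inv₀, map_inv₀] at this
    have h0 : 0 < B.valuation (algebraMap L K a) := by
      rw [zero_lt_iff]; simpa using ha
    exact (inv_le_one₀ h0).1 this
  · have h1 : φ X ∈ B.nonunits := hB ⟨t, Ideal.subset_span rfl, rfl⟩
    have h2 := B.mem_nonunits_iff.1 h1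
    rw [map_inv₀]
    refine (one_lt_inv₀ ?_).2 h2
    rw [zero_lt_iff]
    simp only [ne_eq, map_eq_zero]
    intro h
    exact Polynomial.X_ne_zero (hφ (h.trans (map_zero φ).symm))

lemma exists_generic (L : Type) [Field L] (q : ℕ) (hq : 2 ≤ q) (b c : L) :
    ∃ (K : Type) (_ : Field K) (_ : Algebra L K) (Γ : Type)
      (_ : LinearOrderedCommGroupWithZero Γ) (v : Valuation K Γ) (x y : K),
      (∀ a : L, a ≠ 0 → v (algebraMap L K a) = 1) ∧ 1 < v y ∧ v x = v y ^ q ∧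
      x * y ^ q = x * y + x ^ 2 + algebraMap L K b - algebraMap L K c * x := by
  obtain ⟨K, _, _, _, Γ, _, v, x, hv, hx⟩ := exists_val L
  have hle : ∀ a : L, v (algebraMap L K a) ≤ 1 := by
    intro a
    by_cases h : a = 0
    · simp [h]
    · exact (hv a h).le
  have hx0 : x ≠ 0 := by rintro rfl; simp at hx
  obtain ⟨y, hy⟩ : ∃ y : K, y ^ q - y + algebraMap L K c = x + algebraMap L K b / x := by
    open Polynomial in
    obtain ⟨y, hy⟩ := IsAlgClosed.exists_root
      ((X ^ q - X : K[X]) + C (algebraMap L K c - (x + algebraMap L K b / x))) (by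
        have h1 : (X ^ q - X : K[X]).degree = q := by
          rw [degree_sub_eq_left_of_degree_lt, degree_X_pow]
          rw [degree_X_pow, degree_X]
          exact_mod_cast (by omega : 1 < q)
        have h2 : (0 : WithBot ℕ) < q := by exact_mod_cast (by omega : 0 < q)
        rw [degree_add_C (by rw [h1]; exact h2), h1]
        exact h2.ne')
    refine ⟨y, ?_⟩
    simp only [IsRoot, eval_add, eval_sub, eval_pow, eval_X, eval_C] at hy
    linear_combination hy
  have hvR : v (x + algebraMap L K b / x) = v x := by
    refine Valuation.map_add_eq_of_lt_left _ ?_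
    rw [map_div₀]
    refine lt_of_le_of_lt ?_ hx
    refine div_le_one_of_le₀ ((hle b).trans hx.le) zero_le
  have hvy : 1 < v y := by
    by_contra! h
    have : v (y ^ q - y + algebraMap L K c) ≤ 1 := by
      refine Valuation.map_add_le _ (Valuation.map_sub_le _ ?_ h) (hle c)
      rw [map_pow]; exact pow_le_one' h q
    rw [hy, hvR] at this
    exact absurd hx (not_lt.2 this)
  refine ⟨K, inferInstance, inferInstance, Γ, inferInstance, v, x, y, hv, hvy, ?_, ?_⟩
  · rw [← hvR, ← hy, ← map_pow]
    have h1 : v y < v (y ^ q) := by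
      rw [map_pow]
      exact lt_self_pow₀ hvy (by omega)
    have h2 : v (y ^ q - y) = v (y ^ q) := Valuation.map_sub_eq_of_lt_left _ h1
    rw [Valuation.map_add_eq_of_lt_left _ (h2 ▸ (hle c).trans_lt (hvy.trans h1)), h2]
  · field_simp at hy
    linear_combination hy

end generic
end Kl
namespace Kl
section stepanov

/-- Affine points of the curve `x (y^q - y + c) = x^2 + b`, `x ≠ 0`. -/
abbrev Pts (L : Type) [Field L] (q : ℕ) (b c : L) : Type :=
  {z : L × L // z.1 ≠ 0 ∧ z.1 * z.2 ^ q = z.1 * z.2 + z.1 ^ 2 + b - c * z.1}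

lemma stepanov (L : Type) [Field L] [Fintype L] (q : ℕ) (hq : 2 ≤ q) (b c : L)
    (p e S : ℕ) [Fact p.Prime] [CharP L p] (hS : S = p ^ e) (hL : Fintype.card L = S ^ 2)
    (hSq : (q + 1) ^ 2 < S) [Fintype (Pts L q b c)] :
    Fintype.card (Pts L q b c) ≤ S ^ 2 + (2 * q + 1) * S := by
  classical
  obtain ⟨K, _, _, Γ, _, v, x, y, hv, hy, hxy, relK⟩ := exists_generic L q hq b c
  let R := K × (Pts L q b c → L)
  let X : R := (x, fun z => z.1.1)
  let Y : R := (y, fun z => z.1.2)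
  have rel : X * Y ^ q = X * Y + X ^ 2 + algebraMap L R b - algebraMap L R c * X := by
    refine Prod.ext ?_ (funext fun z => ?_)
    · exact relK
    · exact z.2.2
  let gen : R →ₐ[L] K := AlgHom.fst L K _
  let ev : Pts L q b c → (R →ₐ[L] L) := fun z => (Pi.evalAlgHom L (fun _ => L) z).comp
    (AlgHom.snd L K _)
  have hvy0 : v y ≠ 0 := (zero_lt_one.trans hy).ne'
  have hvM : ∀ w, v (gen (M q X Y w)) = v y ^ w := by
    intro w
    have : gen (M q X Y w) = x ^ (w / q) * y ^ (w % q) := by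
      rw [M, map_mul, map_pow, map_pow]
      rfl
    rw [this, map_mul, map_pow, map_pow, hxy, ← pow_mul, ← pow_add, Nat.div_add_mod]
  have hpinj : Function.Injective (fun n : ℕ => v y ^ n) := pow_right_injective₀ (zero_lt_one.trans hy) hy.ne'
  have hI : Indep L gen q X Y := by
    refine val_indep v hv _ (fun i => ?_) (fun i j h => ?_)
    · rw [hvM]; exact pow_ne_zero _ hvy0
    · simp only [hvM] at h
      have := hpinj h
      omega
  have hS0 : 0 < S := by omega
  have hqS : q + 1 < S := by nlinarith
  have hfrob : ∀ {κ : Type} [Fintype κ] (f : κ → L), (∑ i, f i) ^ S = ∑ i, f i ^ S := by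
    intro κ _ f
    rw [hS, sum_pow_char_pow]
  -- the unknown coefficients
  let ι := Fin (S - q) × Fin (S + q + 1)
  let m := S + 2 * q
  let T := S * (S - 1) + m
  have hmemT : ∀ i : ι, M q X Y (q + i.1) ^ S * M q X Y (q + i.2) ∈ V L q X Y T := by
    intro i
    refine V_mul hq rel ?_ (M_mem (by omega) ?_)
    · have h1 : M q X Y (q + i.1) ∈ V L q X Y (S - 1) :=
        M_mem (by omega) (by have := i.1.2; omega)
      have := V_pow hq rel h1 (S - 1)
      rwa [Nat.sub_add_cancel hS0] at this
    · have := i.2.2; simp only [m]; omega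
  let Φ : (ι → L) →ₗ[L] V L q X Y T :=
    LinearMap.codRestrict _ (Fintype.linearCombination L
      (fun i : ι => M q X Y (q + i.1) ^ S * M q X Y (q + i.2)))
      (fun g => by
        rw [Fintype.linearCombination_apply]
        exact Submodule.sum_mem _ fun i _ => Submodule.smul_mem _ _ (hmemT i))
  have hker : LinearMap.ker Φ ≠ ⊥ := by
    apply LinearMap.ker_ne_bot_of_finrank_lt
    rw [finrank_V hI, Module.finrank_pi]
    simp only [ι, Fintype.card_prod, Fintype.card_fin, T, m]
    obtain ⟨k, rfl⟩ : ∃ k, S = q + 1 + k := ⟨S - q - 1, by omega⟩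
    rw [show q + 1 + k - q = k + 1 by omega, show q + 1 + k - 1 = q + k by omega]
    zify [show q ≤ (q + 1 + k) * (q + k) + (q + 1 + k + 2 * q) + 1 by nlinarith]
    zify at hSq
    nlinarith
  obtain ⟨g, hg, hg0⟩ := Submodule.exists_mem_ne_zero_of_ne_bot hker
  have hΦ : ∑ i : ι, g i • (M q X Y (q + i.1) ^ S * M q X Y (q + i.2)) = 0 := by
    have := congrArg Subtype.val (LinearMap.mem_ker.1 hg)
    simpa [Φ, Fintype.linearCombination_apply] using this
  let G : R := ∑ i : ι, g i ^ S • (M q X Y (q + i.1) * M q X Y (q + i.2) ^ S)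
  have hGm : G ∈ V L q X Y (S - 1 + S * m) := by
    refine Submodule.sum_mem _ fun i _ => Submodule.smul_mem _ _ (V_mul hq rel ?_ ?_)
    · exact M_mem (by omega) (by have := i.1.2; omega)
    · have h1 : M q X Y (q + i.2) ∈ V L q X Y m :=
        M_mem (by omega) (by have := i.2.2; simp only [m]; omega)
      have := V_pow hq rel h1 (S - 1)
      rwa [Nat.sub_add_cancel hS0] at this
  have hG0 : gen G ≠ 0 := by
    have hind : LinearIndependent L
        (fun i : ι => gen (M q X Y (q + i.1) * M q X Y (q + i.2) ^ S)) := by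
      have hval : ∀ i : ι, v (gen (M q X Y (q + i.1) * M q X Y (q + i.2) ^ S)) =
          v y ^ ((q + i.1) + S * (q + i.2)) := by
        intro i
        rw [map_mul, map_pow, map_mul, map_pow, hvM, hvM, ← pow_mul, ← pow_add, mul_comm S]
      refine val_indep v hv _ (fun i => ?_) (fun i j h => ?_)
      · rw [hval]; exact pow_ne_zero _ hvy0
      · simp only [hval] at h
        have h := hpinj h
        have hi := i.1.2
        have hj := j.1.2
        have h1 : q + (i.1 : ℕ) = q + j.1 := by
          have := congrArg (· % S) h
          simp only [Nat.add_mul_mod_self_left] at this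
          rwa [Nat.mod_eq_of_lt (by omega), Nat.mod_eq_of_lt (by omega)] at this
        have h2 : S * (q + (i.2 : ℕ)) = S * (q + j.2) := by omega
        have h3 := Nat.eq_of_mul_eq_mul_left hS0 h2
        exact Prod.ext (Fin.ext (by omega)) (Fin.ext (by omega))
    intro h
    apply hg0
    have h' : ∑ i : ι, g i ^ S • gen (M q X Y (q + i.1) * M q X Y (q + i.2) ^ S) = 0 := by
      rw [← h, map_sum]
      simp only [map_smul]
    have := Fintype.linearIndependent_iff.1 hind _ h'
    funext i
    exact pow_eq_zero_iff hS0.ne' |>.1 (this i)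
  have hcard : ∀ a : L, (a ^ S) ^ S = a := by
    intro a
    rw [← pow_mul, ← sq, ← hL, FiniteField.pow_card]
  have hz : ∀ z, ev z G = 0 := by
    intro z
    have h1 : (ev z G) ^ S = 0 := by
      have h2 := congrArg (ev z) hΦ
      rw [map_zero, map_sum] at h2
      rw [← h2, map_sum, hfrob]
      refine Finset.sum_congr rfl fun i _ => ?_
      rw [map_smul, map_smul, map_mul, map_mul, map_pow, map_pow, smul_eq_mul, smul_eq_mul,
        mul_pow, mul_pow, hcard, hcard]
    exact pow_eq_zero_iff hS0.ne' |>.1 h1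
  have := zero_count hq rel hI ev (fun z => z.2.1)
    (fun z z' h1 h2 => Subtype.ext (Prod.ext h1 h2)) hGm hG0 hz
  refine this.trans ?_
  simp only [m]
  have : S * (S + 2 * q) = S ^ 2 + 2 * q * S := by ring
  rw [this, add_mul]
  omega

end stepanov
end Kl
namespace Kl
section klo

lemma mem_range_of_pow {k L : Type} [Field k] [Fintype k] [Field L] [Algebra k L] (y : L)
    (h : y ^ (Fintype.card k) = y) : ∃ c : k, algebraMap k L c = y := by
  classical
  have hq : 1 < Fintype.card k := Fintype.one_lt_card
  set P : Polynomial L := Polynomial.X ^ (Fintype.card k) - Polynomial.X with hP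
  have hP0 : P ≠ 0 := FiniteField.X_pow_card_sub_X_ne_zero L hq
  have hdeg : P.natDegree = Fintype.card k := FiniteField.X_pow_card_sub_X_natDegree_eq L hq
  have hsub : Finset.univ.image (algebraMap k L) ⊆ P.roots.toFinset := by
    intro z hz
    obtain ⟨c, _, rfl⟩ := Finset.mem_image.1 hz
    rw [Multiset.mem_toFinset, Polynomial.mem_roots hP0]
    simp [hP, ← map_pow, FiniteField.pow_card]
  have hc : (Finset.univ.image (algebraMap k L)).card = Fintype.card k := by
    rw [Finset.card_image_of_injective _ (algebraMap k L).injective, Finset.card_univ]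
  have heq := Finset.eq_of_subset_of_card_le hsub (by
    rw [hc, ← hdeg]
    exact (Multiset.toFinset_card_le _).trans (Polynomial.card_roots' P))
  have hy : y ∈ Finset.univ.image (algebraMap k L) := by
    rw [heq, Multiset.mem_toFinset, Polynomial.mem_roots hP0]
    simp [hP, h]
  obtain ⟨c, _, hc⟩ := Finset.mem_image.1 hy
  exact ⟨c, hc⟩

lemma h90 {k L : Type} [Field k] [Fintype k] [Field L] [Finite L] [Algebra k L] (x : L)
    (h : Algebra.trace k L x = 0) : ∃ y : L, y ^ (Fintype.card k) - y = x := by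
  let P : L →ₗ[k] L := (FiniteField.frobeniusAlgHom k L).toLinearMap - LinearMap.id
  have hP : ∀ y, P y = y ^ (Fintype.card k) - y := fun y => by
    simp [P, FiniteField.coe_frobeniusAlgHom]
  have hle : LinearMap.range P ≤ LinearMap.ker (Algebra.trace k L) := by
    rintro _ ⟨y, rfl⟩
    rw [LinearMap.mem_ker, hP, map_sub, sub_eq_zero]
    have := Algebra.trace_eq_of_algEquiv (FiniteField.frobeniusAlgEquivOfAlgebraic k L) y
    simpa [FiniteField.coe_frobeniusAlgEquivOfAlgebraic] using this
  have hker : Module.finrank k (LinearMap.ker P) ≤ 1 := by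
    have : LinearMap.ker P ≤ LinearMap.range (Algebra.linearMap k L) := by
      intro y hy
      rw [LinearMap.mem_ker, hP, sub_eq_zero] at hy
      exact mem_range_of_pow y hy
    refine (Submodule.finrank_mono this).trans ?_
    refine (LinearMap.finrank_range_le _).trans ?_
    simp
  have h1 := LinearMap.finrank_range_add_finrank_ker P
  have h2 := LinearMap.finrank_range_add_finrank_ker (Algebra.trace k L)
  rw [LinearMap.range_eq_top.2 (Algebra.trace_surjective k L), finrank_top, Module.finrank_self] at h2
  have h3 := Submodule.eq_of_le_of_finrank_le hle (by omega)
  have h4 : x ∈ LinearMap.range P := by rw [h3]; exact h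
  obtain ⟨y, hy⟩ := h4
  exact ⟨y, by rw [← hP, hy]⟩

open Classical in
/-- Kloosterman type sum attached to a function `f`. -/
noncomputable def Kl (L : Type) [Field L] [Fintype L] (f : L → ℂ) (b : L) : ℂ :=
  ∑ s : L, if s = 0 then 0 else f (s + b / s)

open Classical in
lemma fiber_bound {k L : Type} [Field k] [Fintype k] [Field L] [Fintype L] [Algebra k L]
    (r : ℕ) (hr : Module.finrank k L = 2 * r)
    (hqr : (Fintype.card k + 1) ^ 2 < Fintype.card k ^ r) (b : L) (u : k) :
    Fintype.card k * (Finset.univ.filter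
      (fun x : L => x ≠ 0 ∧ Algebra.trace k L (x + b / x) = u)).card ≤
      (Fintype.card k ^ r) ^ 2 + (2 * Fintype.card k + 1) * Fintype.card k ^ r := by
  obtain ⟨c, hc⟩ := Algebra.trace_surjective k L u
  obtain ⟨p, hp⟩ := CharP.exists k
  obtain ⟨n, hpp, hn⟩ := FiniteField.card k p
  haveI : Fact p.Prime := ⟨hpp⟩
  haveI : CharP L p := charP_of_injective_algebraMap (algebraMap k L).injective p
  have hcard : Fintype.card L = (Fintype.card k ^ r) ^ 2 := by
    rw [Module.card_eq_pow_finrank (K := k) (V := L), hr, ← pow_mul, mul_comm]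
  have hq2 : 2 ≤ Fintype.card k := Fintype.one_lt_card
  refine le_trans ?_ (stepanov L (Fintype.card k) hq2 b c p (n * r) _
    (by rw [hn, pow_mul]) hcard hqr)
  have key : ∀ x : {x : L // x ≠ 0 ∧ Algebra.trace k L (x + b / x) = u},
      ∃ y : L, y ^ (Fintype.card k) - y = x.1 + b / x.1 - c := fun x => h90 _ (by
        rw [map_sub, x.2.2, hc, sub_self])
  choose Y hY using key
  have : Fintype.card k * (Finset.univ.filter
      (fun x : L => x ≠ 0 ∧ Algebra.trace k L (x + b / x) = u)).card =
      Fintype.card (k × {x : L // x ≠ 0 ∧ Algebra.trace k L (x + b / x) = u}) := by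
    rw [Fintype.card_prod, Fintype.card_subtype]
  rw [this]
  refine Fintype.card_le_of_injective (fun z => ⟨(z.2.1, Y z.2 + algebraMap k L z.1), z.2.2.1, ?_⟩) ?_
  · have h0 := z.2.2.1
    have h1 := hY z.2
    have h2 : (Y z.2 + algebraMap k L z.1) ^ (Fintype.card k) =
        Y z.2 ^ (Fintype.card k) + algebraMap k L z.1 := by
      have := map_add (FiniteField.frobeniusAlgHom k L) (Y z.2) (algebraMap k L z.1)
      simpa [FiniteField.coe_frobeniusAlgHom, ← map_pow, FiniteField.pow_card] using this
    simp only
    rw [h2]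
    have h3 : b = z.2.1 * (b / z.2.1) := by field_simp
    linear_combination (z.2.1) * h1 - h3
  · rintro ⟨e, x⟩ ⟨e', x'⟩ h
    simp only [Subtype.mk.injEq, Prod.mk.injEq] at h
    obtain ⟨h1, h2⟩ := h
    have h1 := Subtype.ext h1
    subst h1
    simpa using h2

open Classical in
lemma rough_bound {k L : Type} [Field k] [Fintype k] [Field L] [Fintype L] [Algebra k L]
    (r : ℕ) (hr : Module.finrank k L = 2 * r)
    (hqr : (Fintype.card k + 1) ^ 2 < Fintype.card k ^ r) (b : L) (ψ : AddChar k ℂ) (hψ : ψ ≠ 1) :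
    ‖Kl L (fun x => ψ (Algebra.trace k L x)) b‖ ≤
      (2 * Fintype.card k + 2) * (Fintype.card k : ℝ) ^ r := by
  have hcard : Fintype.card L = (Fintype.card k ^ r) ^ 2 := by
    rw [Module.card_eq_pow_finrank (K := k) (V := L), hr, ← pow_mul, mul_comm]
  have hfb := fiber_bound (k := k) r hr hqr b
  set q := Fintype.card k with hq
  have hq0 : (0 : ℝ) < q := by rw [hq]; exact_mod_cast Fintype.card_pos
  set N : k → ℕ := fun u => (Finset.univ.filter
      (fun x : L => x ≠ 0 ∧ Algebra.trace k L (x + b / x) = u)).card with hN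
  have h1 : Kl L (fun x => ψ (Algebra.trace k L x)) b = ∑ u : k, (N u : ℂ) * ψ u := by
    unfold Kl
    rw [← Finset.sum_fiberwise (s := Finset.univ) (g := fun x : L => Algebra.trace k L (x + b / x))]
    refine Finset.sum_congr rfl fun u _ => ?_
    rw [hN]
    simp only [Finset.card_filter]
    push_cast
    rw [Finset.sum_filter, Finset.sum_mul]
    refine Finset.sum_congr rfl fun x _ => ?_
    by_cases hx : x = 0
    · simp [hx]
    · by_cases h : Algebra.trace k L (x + b / x) = u
      · simp [hx, ← h]
      · rw [if_neg h, if_neg (fun h' => h h'.2)]; simp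
  have h2 : ∑ u, N u = q ^ r * q ^ r - 1 := by
    have := Finset.card_eq_sum_card_fiberwise (s := Finset.univ.filter (fun x : L => x ≠ 0))
      (t := Finset.univ) (f := fun x : L => Algebra.trace k L (x + b / x)) (by intro x _; simp)
    simp only [Finset.filter_filter] at this
    rw [← this, Finset.filter_ne', Finset.card_erase_of_mem (Finset.mem_univ _), Finset.card_univ,
      hcard, sq]
  set S : ℝ := (q : ℝ) ^ r with hS
  have hS1 : 1 ≤ S := one_le_pow₀ (by rw [hq]; exact_mod_cast Fintype.card_pos)
  set B : ℝ := (S ^ 2 + (2 * q + 1) * S) / q with hB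
  have h3 : ∀ u, (N u : ℝ) ≤ B := by
    intro u
    rw [hB, le_div_iff₀ hq0, mul_comm]
    have h' : ((q * N u : ℕ) : ℝ) ≤ (((q ^ r) ^ 2 + (2 * q + 1) * q ^ r : ℕ) : ℝ) := by
      exact_mod_cast hfb u
    push_cast at h'
    exact h'
  have h4 : ∑ u, (N u : ℝ) = S * S - 1 := by
    have : 1 ≤ q ^ r * q ^ r := Nat.one_le_iff_ne_zero.2 (by
      have : q ≠ 0 := by rintro h; simp [h] at hq0
      positivity)
    have h2' : ((∑ u, N u : ℕ) : ℝ) = ((q ^ r * q ^ r - 1 : ℕ) : ℝ) := by rw [h2]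
    rw [Nat.cast_sub this] at h2'
    push_cast at h2'
    exact h2'
  have h5 : ∑ u : k, (N u : ℂ) * ψ u = ∑ u : k, ((N u - B : ℝ) : ℂ) * ψ u := by
    have : ∑ u : k, ψ u = 0 := AddChar.sum_eq_zero_of_ne_one hψ
    push_cast
    simp only [sub_mul, Finset.sum_sub_distrib, ← Finset.mul_sum, this, mul_zero, sub_zero]
  rw [h1, h5]
  refine (norm_sum_le _ _).trans ?_
  have h6 : ∀ u : k, ‖((N u - B : ℝ) : ℂ) * ψ u‖ = B - N u := by
    intro u
    rw [norm_mul, AddChar.norm_apply, mul_one, Complex.norm_real, Real.norm_eq_abs,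
      abs_sub_comm, abs_of_nonneg (sub_nonneg.2 (h3 u))]
  simp only [h6, Finset.sum_sub_distrib, h4, Finset.sum_const, Finset.card_univ, ← hq, nsmul_eq_mul]
  have : (q : ℝ) * B = S ^ 2 + (2 * q + 1) * S := by rw [hB]; field_simp
  rw [this]
  nlinarith

lemma sum_sq {k : Type} [Field k] [Fintype k] [DecidableEq k] (hF : ringChar k ≠ 2) (f : k → ℂ) :
    ∑ v, f (v ^ 2) = ∑ w, (1 + (quadraticChar k w : ℂ)) * f w := by
  rw [← Finset.sum_fiberwise (s := Finset.univ) (g := fun v : k => v ^ 2)]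
  refine Finset.sum_congr rfl fun w _ => ?_
  have h := quadraticChar_card_sqrts hF w
  have e : {x : k | x ^ 2 = w}.toFinset = Finset.univ.filter (fun v => v ^ 2 = w) := by
    ext; simp
  rw [e] at h
  rw [Finset.sum_congr rfl (g := fun _ => f w) (by intro v hv; rw [(Finset.mem_filter.1 hv).2]),
    Finset.sum_const, nsmul_eq_mul]
  have h' := congrArg (fun z : ℤ => (z : ℂ)) h
  push_cast at h'
  rw [h', add_comm]

lemma sum_sq_two {k : Type} [Field k] [Fintype k] (hF : ringChar k ≠ 2) (f : k → ℂ)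
    (δ : k) (hδ : ¬ IsSquare δ) :
    ∑ v, f (δ * v ^ 2) + ∑ v, f (v ^ 2) = 2 * ∑ w, f w := by
  classical
  have hδ0 : δ ≠ 0 := by rintro rfl; exact hδ (by simp)
  have hχ : quadraticChar k δ = -1 := quadraticChar_neg_one_iff_not_isSquare.2 hδ
  rw [sum_sq hF (fun w => f (δ * w)), sum_sq hF f]
  have re : ∀ g : k → ℂ, ∑ w, g w = ∑ w, g (δ * w) := fun g =>
    (Equiv.sum_comp (Equiv.mulLeft₀ δ hδ0) g).symm
  rw [re (fun w => (1 + (quadraticChar k w : ℂ)) * f w), re f, ← Finset.sum_add_distrib,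
    Finset.mul_sum]
  refine Finset.sum_congr rfl fun w _ => ?_
  simp only [map_mul, hχ]
  push_cast
  ring

end klo
end Kl
namespace Kl
section dbl

lemma two_ne {k : Type} [Field k] (hF : ringChar k ≠ 2) : (2 : k) ≠ 0 := Ring.two_ne_zero hF

lemma sum_shift {k : Type} [Field k] [Fintype k] [DecidableEq k] (ψ : AddChar k ℂ) (hψ : ψ ≠ 1) (c : k) :
    ∑ u, ψ (u * c) = if c = 0 then (Fintype.card k : ℂ) else 0 := by
  have := AddChar.sum_mulShift (ψ := ψ) c (AddChar.IsPrimitive.of_ne_one hψ)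
  rw [this]; split_ifs <;> simp

open Classical in
/-- auxiliary two-variable function -/
noncomputable def hh {k : Type} [Field k] (ψ : AddChar k ℂ) (b u w : k) : ℂ :=
  if u ^ 2 - w = 0 then 0 else ψ (2 * u + 2 * b * u / (u ^ 2 - w))

lemma hh_total {k : Type} [Field k] [Fintype k] (hF : ringChar k ≠ 2) (ψ : AddChar k ℂ)
    (hψ : ψ ≠ 1) (b : k) (hb : b ≠ 0) : ∑ u, ∑ w, hh ψ b u w = Fintype.card k := by
  classical
  have h2 := two_ne hF
  have e1 : ∀ u, ∑ w, hh ψ b u w = ∑ n, if n = 0 then 0 else ψ (u * (2 * (1 + b / n))) := by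
    intro u
    rw [← Equiv.sum_comp (Equiv.subLeft (u ^ 2))]
    refine Finset.sum_congr rfl fun n _ => ?_
    simp only [hh, Equiv.subLeft_apply, sub_sub_cancel]
    split_ifs with h
    · rfl
    · congr 1; field_simp
  simp only [e1]
  rw [Finset.sum_comm]
  rw [Finset.sum_eq_single (-b)]
  · simp only [neg_eq_zero, hb, if_false]
    rw [sum_shift ψ hψ, if_pos]
    field_simp; ring
  · intro n _ hn
    by_cases h : n = 0
    · simp [h]
    · simp only [h, if_false]
      rw [sum_shift ψ hψ, if_neg]
      intro h'
      apply hn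
      have := (mul_eq_zero.1 h').resolve_left h2
      field_simp at this
      linear_combination this
  · simp

lemma kl_sq {k : Type} [Field k] [Fintype k] (hF : ringChar k ≠ 2) (ψ : AddChar k ℂ)
    (b : k) : Kl k ψ b ^ 2 = ∑ u, ∑ v, hh ψ b u (v ^ 2) := by
  classical
  have h2 := two_ne hF
  unfold Kl
  rw [sq, Finset.sum_mul_sum, ← Finset.sum_product', ← Finset.sum_product']
  symm
  refine Finset.sum_bij' (fun z _ => (z.1 + z.2, z.1 - z.2))
    (fun z _ => ((z.1 + z.2) / 2, (z.1 - z.2) / 2)) (by simp) (by simp) ?_ ?_ ?_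
  · rintro ⟨u, v⟩ _
    ext <;> simp <;> field_simp <;> ring
  · rintro ⟨u, v⟩ _
    ext <;> simp <;> field_simp <;> ring
  · rintro ⟨u, v⟩ _
    simp only [hh]
    have e : u ^ 2 - v ^ 2 = (u + v) * (u - v) := by ring
    rw [e]
    by_cases h1 : u + v = 0
    · simp [h1]
    by_cases h3 : u - v = 0
    · simp [h3]
    simp only [h1, h3, mul_eq_zero, or_self, if_false]
    rw [← AddChar.map_add_eq_mul]
    congr 1
    field_simp
    ring

lemma doubling {k : Type} [Field k] [Fintype k] (hF : ringChar k ≠ 2) (ψ : AddChar k ℂ)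
    (hψ : ψ ≠ 1) (b : k) (hb : b ≠ 0) :
    ∃ (L : Type) (_ : Field L) (_ : Fintype L) (_ : Algebra k L), Module.finrank k L = 2 ∧
      Kl L (fun x => ψ (Algebra.trace k L x)) (algebraMap k L b) =
        2 * Fintype.card k - Kl k ψ b ^ 2 := by
  classical
  obtain ⟨δ, hδ⟩ := FiniteField.exists_nonsquare hF
  haveI : Fact (∀ r : k, r ^ 2 ≠ δ + 0 * r) := ⟨fun r h => hδ ⟨r, by rw [← sq, h]; ring⟩⟩
  let fL : Fintype (QuadraticAlgebra k δ 0) := Fintype.ofEquiv _ (QuadraticAlgebra.equivProd δ 0).symm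
  refine ⟨QuadraticAlgebra k δ 0, inferInstance, fL, inferInstance,
    QuadraticAlgebra.finrank_eq_two δ 0, ?_⟩
  have htr : ∀ z : QuadraticAlgebra k δ 0, Algebra.trace k _ z = 2 * z.re := by
    intro z
    rw [Algebra.trace_eq_matrix_trace (QuadraticAlgebra.basis δ 0), Matrix.trace_fin_two]
    have e : ∀ i j, ((QuadraticAlgebra.basis δ (0 : k)).repr (QuadraticAlgebra.basis δ (0 : k) i)) j =
        if i = j then 1 else 0 := fun i j => by
      rw [Module.Basis.repr_self, Finsupp.single_apply]
    have e00 : (QuadraticAlgebra.basis δ (0 : k) 0).re = 1 := (e 0 0).trans (by simp)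
    have e01 : (QuadraticAlgebra.basis δ (0 : k) 0).im = 0 := (e 0 1).trans (by simp)
    have e10 : (QuadraticAlgebra.basis δ (0 : k) 1).re = 0 := (e 1 0).trans (by simp)
    have e11 : (QuadraticAlgebra.basis δ (0 : k) 1).im = 1 := (e 1 1).trans (by simp)
    simp [Algebra.leftMulMatrix_eq_repr_mul, e00, e01, e10, e11]
    ring
  have hL : Kl (QuadraticAlgebra k δ 0) (fun x => ψ (Algebra.trace k _ x)) (algebraMap k _ b) =
      ∑ u, ∑ v, hh ψ b u (δ * v ^ 2) := by
    unfold Kl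
    rw [← Finset.sum_product', ← Equiv.sum_comp (QuadraticAlgebra.equivProd δ 0).symm]
    refine Finset.sum_congr (by rfl) ?_
    rintro ⟨u, v⟩ _
    set z : QuadraticAlgebra k δ 0 := (QuadraticAlgebra.equivProd δ 0).symm (u, v) with hz
    have hre : z.re = u := rfl
    have him : z.im = v := rfl
    have hn : z.norm = u ^ 2 - δ * v ^ 2 := by
      rw [QuadraticAlgebra.norm_def, hre, him]; ring
    simp only [hh]
    rw [← hn]
    by_cases h0 : z = 0
    · rw [if_pos h0, if_pos (by rw [h0]; simp)]
    · have hn0 : z.norm ≠ 0 := fun h => h0 (QuadraticAlgebra.norm_eq_zero_iff_eq_zero.1 h)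
      rw [if_neg h0, if_neg hn0, htr]
      congr 1
      have : (algebraMap k (QuadraticAlgebra k δ 0) b / z) = b • z⁻¹ := by
        rw [div_eq_mul_inv, Algebra.smul_def]
      rw [this, QuadraticAlgebra.inv_def]
      simp [hre, him]
      field_simp
  rw [hL, kl_sq hF]
  have := hh_total hF ψ hψ b hb
  have h3 : ∑ u, (∑ v, hh ψ b u (δ * v ^ 2) + ∑ v, hh ψ b u (v ^ 2)) = ∑ u, 2 * ∑ w, hh ψ b u w :=
    Finset.sum_congr rfl fun u _ => sum_sq_two hF (hh ψ b u) δ hδ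
  rw [← Finset.mul_sum, this, Finset.sum_add_distrib] at h3
  rw [← h3]; ring

end dbl
end Kl
namespace Kl
section twr

/-- the sequence of Kloosterman sums in the tower -/
noncomputable def kap (q : ℂ) (κ : ℂ) : ℕ → ℂ
  | 0 => κ
  | m + 1 => 2 * q ^ (2 ^ m) - (kap q κ m) ^ 2

lemma tower {k : Type} [Field k] [Fintype k] (hF : ringChar k ≠ 2) (ψ : AddChar k ℂ)
    (hψ : ψ ≠ 1) (b : k) (hb : b ≠ 0) (m : ℕ) :
    ∃ (L : Type) (_ : Field L) (_ : Fintype L) (_ : Algebra k L), Module.finrank k L = 2 ^ m ∧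
      Kl L (fun x => ψ (Algebra.trace k L x)) (algebraMap k L b) =
        kap (Fintype.card k) (Kl k ψ b) m := by
  induction m with
  | zero =>
    refine ⟨k, inferInstance, inferInstance, inferInstance, by simp, ?_⟩
    simp [kap, Algebra.trace_self]
  | succ m ih =>
    obtain ⟨L, i1, i2, i3, hr, hk⟩ := ih
    let ψL : AddChar L ℂ := ψ.compAddMonoidHom (Algebra.trace k L).toAddMonoidHom
    have hψL : ∀ x, ψL x = ψ (Algebra.trace k L x) := fun x => rfl
    have hψL1 : ψL ≠ 1 := by
      obtain ⟨a, ha⟩ := AddChar.ne_one_iff.1 hψ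
      obtain ⟨c, hc⟩ := Algebra.trace_surjective k L a
      exact AddChar.ne_one_iff.2 ⟨c, by rw [hψL, hc]; exact ha⟩
    have hFL : ringChar L ≠ 2 := by rwa [← Algebra.ringChar_eq k L]
    obtain ⟨L', j1, j2, j3, hr', hk'⟩ := doubling hFL ψL hψL1 (algebraMap k L b)
      (by simpa using hb)
    letI : Algebra k L' := ((algebraMap L L').comp (algebraMap k L)).toAlgebra
    haveI : IsScalarTower k L L' := IsScalarTower.of_algebraMap_eq' rfl
    refine ⟨L', j1, j2, inferInstance, ?_, ?_⟩
    · rw [← Module.finrank_mul_finrank k L L', hr, hr', pow_succ]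
    · have e : (fun x : L' => ψ (Algebra.trace k L' x)) = fun x => ψL (Algebra.trace L L' x) := by
        funext x
        rw [hψL, Algebra.trace_trace]
      rw [e, IsScalarTower.algebraMap_apply k L L', hk']
      have : (ψL : L → ℂ) = fun x => ψ (Algebra.trace k L x) := rfl
      rw [this, hk, Module.card_eq_pow_finrank (K := k) (V := L), hr]
      simp [kap]

theorem kl_bound {k : Type} [Field k] [Fintype k] (hF : ringChar k ≠ 2) (ψ : AddChar k ℂ)
    (hψ : ψ ≠ 1) (b : k) (hb : b ≠ 0) : ‖Kl k ψ b‖ ≤ 2 * √(Fintype.card k : ℝ) := by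
  by_contra hcon
  push Not at hcon
  set q := Fintype.card k with hq
  have hq1 : 1 < q := Fintype.one_lt_card
  have hq0 : (0 : ℝ) < q := by positivity
  have hq3 : 3 ≤ q := by
    have := FiniteField.odd_card_of_char_ne_two hF
    omega
  have hs0 : 0 < √(q : ℝ) := Real.sqrt_pos.2 hq0
  set ε : ℝ := ‖Kl k ψ b‖ / √(q : ℝ) - 2 with hε
  have hε0 : 0 < ε := by
    rw [hε, sub_pos, lt_div_iff₀ hs0]; exact hcon
  have hrec : ∀ m, (2 + 4 ^ m * ε) * √(q : ℝ) ^ (2 ^ m) ≤ ‖kap q (Kl k ψ b) m‖ := by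
    intro m
    induction m with
    | zero =>
      simp only [kap, hε, pow_zero, pow_one, one_mul]
      apply le_of_eq; field_simp; ring
    | succ m ih =>
      set Q := √(q : ℝ) ^ (2 ^ m) with hQ
      have hQ0 : 0 < Q := by positivity
      have hQ2 : (q : ℝ) ^ (2 ^ m) = Q ^ 2 := by
        rw [hQ, ← pow_mul, mul_comm, pow_mul, Real.sq_sqrt hq0.le]
      have hQ3 : √(q : ℝ) ^ (2 ^ (m + 1)) = Q ^ 2 := by
        rw [hQ, ← pow_mul, pow_succ 2 m]
      simp only [kap]
      have h1 := norm_sub_norm_le ((kap q (Kl k ψ b) m) ^ 2) (2 * (q : ℂ) ^ (2 ^ m))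
      rw [norm_sub_rev, norm_pow, norm_mul, norm_pow, Complex.norm_natCast, hQ2] at h1
      rw [hQ3]
      refine le_trans ?_ h1
      have h2 : ((2 + 4 ^ m * ε) * Q) ^ 2 ≤ ‖kap q (Kl k ψ b) m‖ ^ 2 :=
        pow_le_pow_left₀ (by positivity) ih 2
      have h3 : ‖(2 : ℂ)‖ = 2 := by simp
      rw [h3]
      have h4 : 0 ≤ (4 ^ m * ε * Q) ^ 2 := by positivity
      rw [pow_succ]
      nlinarith
  have hup : ∀ m, 2 + 4 ^ (m + 3) * ε ≤ 2 * q + 2 := by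
    intro m
    obtain ⟨L, i1, i2, i3, hr, hk⟩ := tower hF ψ hψ b hb (m + 3)
    have hr' : Module.finrank k L = 2 * 2 ^ (m + 2) := by rw [hr]; ring
    have hq4 : (q + 1) ^ 2 < q ^ 4 := by
      rw [show q ^ 4 = (q ^ 2) ^ 2 by ring]
      exact Nat.pow_lt_pow_left (by nlinarith) (by norm_num)
    have hqr : (q + 1) ^ 2 < q ^ (2 ^ (m + 2)) := by
      calc (q + 1) ^ 2 < q ^ 4 := hq4
        _ ≤ q ^ (2 ^ (m + 2)) := Nat.pow_le_pow_right (by omega) (by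
          have : 1 ≤ 2 ^ m := Nat.one_le_two_pow
          rw [pow_add]; omega)
    have h1 := rough_bound (k := k) (L := L) (2 ^ (m + 2)) hr' hqr (algebraMap k L b) ψ hψ
    rw [hk] at h1
    have h2 := (hrec (m + 3)).trans h1
    have h3 : √(q : ℝ) ^ (2 ^ (m + 3)) = (q : ℝ) ^ (2 ^ (m + 2)) := by
      rw [show 2 ^ (m + 3) = 2 * 2 ^ (m + 2) by ring, pow_mul, Real.sq_sqrt hq0.le]
    rw [h3] at h2
    exact le_of_mul_le_mul_right h2 (by positivity)
  obtain ⟨m, hm⟩ := pow_unbounded_of_one_lt ((2 * q : ℝ) / ε) (by norm_num : (1 : ℝ) < 4)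
  have := hup m
  rw [div_lt_iff₀ hε0] at hm
  have h5 : (4 : ℝ) ^ (m + 3) * ε = 64 * (4 ^ m * ε) := by ring
  have : 0 < 4 ^ m * ε := by positivity
  linarith

end twr
end Kl
namespace Kl
section sal

variable {k : Type} [Field k] [Fintype k] [DecidableEq k]

/-- complex valued quadratic character -/
noncomputable def chi (k : Type) [Field k] [Fintype k] [DecidableEq k] : MulChar k ℂ :=
  (quadraticChar k).ringHomComp (Int.castRingHom ℂ)

lemma chi_apply (x : k) : chi k x = (quadraticChar k x : ℂ) := rfl

lemma chi_sq {x : k} (hx : x ≠ 0) : chi k x * chi k x = 1 := by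
  rw [chi_apply, ← Int.cast_mul, ← sq, quadraticChar_sq_one hx, Int.cast_one]

/-- quadratic Gauss sum -/
noncomputable def gs (ψ : AddChar k ℂ) : ℂ := ∑ w, chi k w * ψ w

lemma gs_norm (hF : ringChar k ≠ 2) (ψ : AddChar k ℂ) (hψ : ψ ≠ 1) :
    ‖gs ψ‖ = √(Fintype.card k : ℝ) := by
  have h1 : chi k ≠ 1 := by
    intro h
    obtain ⟨δ, hδ⟩ := FiniteField.exists_nonsquare hF
    have hδ0 : δ ≠ 0 := by rintro rfl; exact hδ (by simp)
    have hχ : quadraticChar k δ = -1 := quadraticChar_neg_one_iff_not_isSquare.2 hδ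
    have h2 : chi k δ = 1 := by rw [h, MulChar.one_apply (Ne.isUnit hδ0)]
    rw [chi_apply, hχ] at h2
    norm_num at h2
  have h2 : (chi k).IsQuadratic := (quadraticChar_isQuadratic k).comp _
  have h3 := gaussSum_sq h1 h2 (AddChar.IsPrimitive.of_ne_one hψ)
  have h4 : gaussSum (chi k) ψ = gs ψ := rfl
  rw [h4] at h3
  have h5 : ‖gs ψ‖ ^ 2 = Fintype.card k := by
    rw [← norm_pow, h3, norm_mul, Complex.norm_natCast]
    have : ‖chi k (-1)‖ * ‖chi k (-1)‖ = 1 := by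
      rw [← norm_mul, chi_sq (by simp), norm_one]
    have : ‖chi k (-1)‖ = 1 := by nlinarith [norm_nonneg (chi k (-1))]
    rw [this, one_mul]
  rw [← h5, Real.sqrt_sq (norm_nonneg _)]

lemma gq (hF : ringChar k ≠ 2) (ψ : AddChar k ℂ) (hψ : ψ ≠ 1) (c : k) (hc : c ≠ 0) :
    ∑ t, ψ (c * t ^ 2) = chi k c * gs ψ := by
  rw [sum_sq hF (fun w => ψ (c * w))]
  simp only [add_mul, one_mul, Finset.sum_add_distrib]
  have h1 : ∑ w, ψ (c * w) = 0 := by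
    simp only [mul_comm c]
    rw [sum_shift ψ hψ, if_neg hc]
  have e := Equiv.sum_comp (Equiv.mulLeft₀ c hc) (fun w => chi k w * ψ w)
  rw [h1, zero_add, gs, ← e, Finset.mul_sum]
  refine Finset.sum_congr rfl fun w _ => ?_
  simp only [Equiv.mulLeft₀_apply, map_mul, chi_apply]
  push_cast
  have := chi_sq hc
  rw [chi_apply] at this
  linear_combination (-(quadraticChar k w : ℂ) * ψ (c * w)) * this

/-- Salié sum -/
noncomputable def Sal (ψ : AddChar k ℂ) (a : k) : ℂ :=
  ∑ s, chi k s * ψ (s + a / s)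

lemma chi_zero : chi k 0 = 0 := by simp [chi_apply]

lemma sal_nonsq (ψ : AddChar k ℂ) (a : k) (ha : ¬ IsSquare a) : Sal ψ a = 0 := by
  have ha0 : a ≠ 0 := by rintro rfl; exact ha (by simp)
  have hχ : chi k a = -1 := by
    rw [chi_apply, quadraticChar_neg_one_iff_not_isSquare.2 ha]; norm_num
  have h : Sal ψ a = - Sal ψ a := by
    conv_lhs => unfold Sal
    rw [← Equiv.sum_comp ((Equiv.inv k).trans (Equiv.mulLeft₀ a ha0)), Sal, ← Finset.sum_neg_distrib]
    refine Finset.sum_congr rfl fun s _ => ?_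
    by_cases hs : s = 0
    · simp [hs, chi_zero]
    simp only [Equiv.trans_apply, Equiv.inv_apply, Equiv.mulLeft₀_apply, map_mul, hχ]
    have h1 : chi k s⁻¹ = chi k s := by
      have e1 := chi_sq hs
      have e2 : chi k s * chi k s⁻¹ = 1 := by rw [← map_mul, mul_inv_cancel₀ hs, map_one]
      have e3 : chi k s ≠ 0 := by intro h; rw [h] at e1; simp at e1
      exact mul_left_cancel₀ e3 (e2.trans e1.symm)
    rw [h1]
    have h2 : a * s⁻¹ + a / (a * s⁻¹) = s + a / s := by field_simp; ring
    rw [h2]; ring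
  have : (2 : ℂ) * Sal ψ a = 0 := by linear_combination h
  simpa using this

lemma sal_fourier (hF : ringChar k ≠ 2) (ψ : AddChar k ℂ) (hψ : ψ ≠ 1) (w : k) :
    ∑ v, Sal ψ (v ^ 2) * ψ (-(v * w)) =
      gs ψ * ((if 1 - w ^ 2 / 4 = 0 then (Fintype.card k : ℂ) else 0) - 1) := by
  have h2 := two_ne hF
  have h4 : (4 : k) ≠ 0 := by
    rw [show (4 : k) = 2 * 2 by norm_num]; exact mul_ne_zero h2 h2
  simp only [Sal, Finset.sum_mul]
  rw [Finset.sum_comm]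
  have h1 : ∀ s : k, ∑ v, chi k s * ψ (s + v ^ 2 / s) * ψ (-(v * w)) =
      gs ψ * (ψ (s * (1 - w ^ 2 / 4)) - if s = 0 then 1 else 0) := by
    intro s
    by_cases hs : s = 0
    · simp [hs, chi_zero]
    rw [if_neg hs, sub_zero]
    have e1 : ∀ v, chi k s * ψ (s + v ^ 2 / s) * ψ (-(v * w)) =
        chi k s * ψ (s * (1 - w ^ 2 / 4)) * ψ (s⁻¹ * (v - s * w / 2) ^ 2) := by
      intro v
      rw [mul_assoc, mul_assoc, ← AddChar.map_add_eq_mul, ← AddChar.map_add_eq_mul]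
      congr 2
      field_simp
      ring
    simp only [e1]
    have e3 := Equiv.sum_comp (Equiv.subRight (s * w / 2)) (fun v => ψ (s⁻¹ * v ^ 2))
    simp only [Equiv.subRight_apply] at e3
    rw [← Finset.mul_sum, e3,
      gq hF ψ hψ _ (inv_ne_zero hs)]
    have e2 : chi k s * chi k s⁻¹ = 1 := by rw [← map_mul, mul_inv_cancel₀ hs, map_one]
    linear_combination (ψ (s * (1 - w ^ 2 / 4)) * gs ψ) * e2
  simp only [h1]
  rw [← Finset.mul_sum, Finset.sum_sub_distrib, sum_shift ψ hψ]
  simp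

lemma sal_sq (hF : ringChar k ≠ 2) (ψ : AddChar k ℂ) (hψ : ψ ≠ 1) (v : k) (hv : v ≠ 0) :
    Sal ψ (v ^ 2) = gs ψ * (ψ (v * 2) + ψ (v * -2)) := by
  have h2 := two_ne hF
  have h4 : (4 : k) ≠ 0 := by
    rw [show (4 : k) = 2 * 2 by norm_num]; exact mul_ne_zero h2 h2
  have hq : (Fintype.card k : ℂ) ≠ 0 := by exact_mod_cast Fintype.card_ne_zero
  have e1 : ∑ w, ψ (v * w) * ∑ v', Sal ψ (v' ^ 2) * ψ (-(v' * w)) = Fintype.card k * Sal ψ (v ^ 2) := by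
    simp only [Finset.mul_sum]
    rw [Finset.sum_comm]
    have : ∀ v', ∑ w, ψ (v * w) * (Sal ψ (v' ^ 2) * ψ (-(v' * w))) =
        Sal ψ (v' ^ 2) * if v - v' = 0 then (Fintype.card k : ℂ) else 0 := by
      intro v'
      rw [← sum_shift ψ hψ, Finset.mul_sum]
      refine Finset.sum_congr rfl fun w _ => ?_
      rw [mul_left_comm, ← AddChar.map_add_eq_mul]
      congr 2; ring
    simp only [this]
    rw [Finset.sum_eq_single v]
    · simp [mul_comm]
    · intro v' _ h
      rw [if_neg (fun h' => h (sub_eq_zero.1 h').symm), mul_zero]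
    · simp
  simp only [sal_fourier hF ψ hψ] at e1
  have e2 : ∑ w, ψ (v * w) * (gs ψ * ((if 1 - w ^ 2 / 4 = 0 then (Fintype.card k : ℂ) else 0) - 1)) =
      gs ψ * (Fintype.card k * (ψ (v * 2) + ψ (v * -2))) := by
    have e3 : ∑ w, ψ (v * w) = 0 := by
      simp only [mul_comm v]
      rw [sum_shift ψ hψ, if_neg hv]
    have e4 : Finset.univ.filter (fun w : k => 1 - w ^ 2 / 4 = 0) = {2, -2} := by
      ext w
      simp only [Finset.mem_filter, Finset.mem_univ, true_and, Finset.mem_insert,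
        Finset.mem_singleton]
      rw [sub_eq_zero, eq_div_iff h4, ← sq_eq_sq_iff_eq_or_eq_neg]
      constructor <;> intro h <;> linear_combination -h
    have e5 : ∑ w, ψ (v * w) * (if 1 - w ^ 2 / 4 = 0 then (Fintype.card k : ℂ) else 0) =
        Fintype.card k * (ψ (v * 2) + ψ (v * -2)) := by
      simp only [mul_ite, mul_zero]
      rw [← Finset.sum_filter, e4, Finset.sum_pair]
      · ring
      · intro h
        apply h4; linear_combination h
    rw [← e5, Finset.mul_sum, ← sub_eq_zero, ← Finset.sum_sub_distrib]
    rw [Finset.sum_congr rfl (g := fun w => (-gs ψ) * ψ (v * w)) (fun w _ => by ring)]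
    rw [← Finset.mul_sum, e3, mul_zero]
  rw [e2] at e1
  apply mul_left_cancel₀ hq
  rw [← e1]; ring

lemma sal_bound (hF : ringChar k ≠ 2) (ψ : AddChar k ℂ) (hψ : ψ ≠ 1) (a : k) :
    ‖Sal ψ a‖ ≤ 2 * √(Fintype.card k : ℝ) := by
  by_cases ha : IsSquare a
  · obtain ⟨v, rfl⟩ := ha
    rw [← sq]
    by_cases hv : v = 0
    · have : Sal ψ (v ^ 2) = gs ψ := by simp [hv, Sal, gs]
      rw [this, gs_norm hF ψ hψ]
      linarith [Real.sqrt_nonneg (Fintype.card k : ℝ)]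
    · rw [sal_sq hF ψ hψ v hv, norm_mul, gs_norm hF ψ hψ, mul_comm]
      refine mul_le_mul_of_nonneg_right ?_ (Real.sqrt_nonneg _)
      refine (norm_add_le _ _).trans ?_
      rw [AddChar.norm_apply, AddChar.norm_apply]; norm_num
  · rw [sal_nonsq ψ a ha, norm_zero]; positivity

/-- generalized sum -/
noncomputable def Sd (ψ : AddChar k ℂ) (d : ℕ) (a : k) : ℂ :=
  ∑ s, if s = 0 then 0 else chi k s ^ d * ψ (s + a / s)

lemma sd_bound (hF : ringChar k ≠ 2) (ψ : AddChar k ℂ) (hψ : ψ ≠ 1) (d : ℕ) (a : k) :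
    ‖Sd ψ d a‖ ≤ 2 * √(Fintype.card k : ℝ) := by
  have hq : (1 : ℝ) ≤ √(Fintype.card k : ℝ) := by
    rw [Real.one_le_sqrt]; exact_mod_cast Fintype.card_pos
  rcases Nat.even_or_odd' d with ⟨m, rfl | rfl⟩
  · have h : Sd ψ (2 * m) a = Kl k ψ a := by
      unfold Sd Kl
      refine Finset.sum_congr rfl fun s _ => ?_
      by_cases hs : s = 0
      · simp [hs]
      · rw [if_neg hs, if_neg hs, pow_mul, sq, chi_sq hs, one_pow, one_mul]
    rw [h]
    by_cases ha : a = 0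
    · have : Kl k ψ a = -1 := by
        unfold Kl
        have e : ∑ s, ψ s = 0 := AddChar.sum_eq_zero_of_ne_one hψ
        have e2 : ∀ s : k, (if s = 0 then 0 else ψ (s + a / s)) = ψ s - if s = 0 then 1 else 0 := by
          intro s; split_ifs with h <;> simp [ha, h]
        rw [Finset.sum_congr rfl (g := fun s => ψ s - if s = 0 then 1 else 0)
          (fun s _ => by rw [← e2 s]; split_ifs <;> rfl), Finset.sum_sub_distrib, e]
        simp
      rw [this, norm_neg, norm_one]; linarith
    · exact kl_bound hF ψ hψ a ha
  · have h : Sd ψ (2 * m + 1) a = Sal ψ a := by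
      unfold Sd Sal
      refine Finset.sum_congr rfl fun s _ => ?_
      by_cases hs : s = 0
      · simp [hs, chi_zero]
      · rw [if_neg hs, pow_succ, pow_mul, sq, chi_sq hs, one_pow, one_mul]
    rw [h]
    exact sal_bound hF ψ hψ a

end sal
end Kl
namespace Kl
section mix

variable {k : Type} [Field k] [Fintype k] [DecidableEq k]

lemma char_sum (ψ : AddChar k ℂ) {ι : Type} (S : Finset ι) (f : ι → k) :
    ψ (∑ i ∈ S, f i) = ∏ i ∈ S, ψ (f i) := by
  classical
  induction S using Finset.induction_on with
  | empty => simp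
  | insert a S ha ih =>
    rw [Finset.sum_insert ha, Finset.prod_insert ha, AddChar.map_add_eq_mul, ih]

lemma coord (hF : ringChar k ≠ 2) (ψ : AddChar k ℂ) (hψ : ψ ≠ 1) (s : k) (hs : s ≠ 0) (z : k) :
    ∑ t, ψ (t * z - t ^ 2 / (4 * s)) = ψ (s * z ^ 2) * (chi k (-s) * gs ψ) := by
  have h2 := two_ne hF
  have h4 : (4 : k) ≠ 0 := by
    rw [show (4 : k) = 2 * 2 by norm_num]; exact mul_ne_zero h2 h2
  have e1 : ∀ t, ψ (t * z - t ^ 2 / (4 * s)) =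
      ψ (s * z ^ 2) * ψ (-(4 * s)⁻¹ * (t - 2 * s * z) ^ 2) := by
    intro t
    rw [← AddChar.map_add_eq_mul]
    congr 1
    field_simp
    ring
  have hc : -(4 * s)⁻¹ ≠ 0 := neg_ne_zero.2 (inv_ne_zero (mul_ne_zero h4 hs))
  have e3 := Equiv.sum_comp (Equiv.subRight (2 * s * z)) (fun v => ψ (-(4 * s)⁻¹ * v ^ 2))
  simp only [Equiv.subRight_apply] at e3
  simp only [e1]
  rw [← Finset.mul_sum, e3, gq hF ψ hψ _ hc]
  congr 2
  have hs' : -s ≠ 0 := neg_ne_zero.2 hs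
  have f1 := chi_sq hs'
  have f2 : chi k (-(4 * s)⁻¹) * chi k (-s) = 1 := by
    rw [← map_mul, show -(4 * s)⁻¹ * -s = (2⁻¹ : k) * 2⁻¹ by field_simp; norm_num, map_mul]
    exact chi_sq (inv_ne_zero h2)
  have f3 : chi k (-s) ≠ 0 := by intro h; rw [h] at f1; simp at f1
  exact mul_right_cancel₀ f3 (f2.trans f1.symm)

lemma vec (hF : ringChar k ≠ 2) (ψ : AddChar k ℂ) (hψ : ψ ≠ 1) (s : k) (hs : s ≠ 0) (d : ℕ)
    (z : Fin d → k) :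
    ∑ ξ : Fin d → k, ψ (∑ j, ξ j * z j) * ψ (-((∑ j, ξ j ^ 2) / (4 * s))) =
      ψ (s * ∑ j, z j ^ 2) * (chi k (-s) * gs ψ) ^ d := by
  have h := Finset.prod_univ_sum (fun _ : Fin d => (Finset.univ : Finset k))
    (fun j t => ψ (t * z j - t ^ 2 / (4 * s)))
  simp only [coord hF ψ hψ s hs, Fintype.piFinset_univ] at h
  rw [Finset.prod_mul_distrib, Finset.prod_const, Finset.card_univ, Fintype.card_fin,
    ← char_sum, ← Finset.mul_sum] at h
  rw [h]
  refine Finset.sum_congr rfl fun ξ _ => ?_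
  rw [← AddChar.map_add_eq_mul, ← char_sum]
  congr 1
  rw [Finset.sum_sub_distrib, Finset.sum_div, sub_eq_add_neg]

lemma kern (hF : ringChar k ≠ 2) (ψ : AddChar k ℂ) (hψ : ψ ≠ 1) (d : ℕ) (z : Fin d → k) :
    gs ψ ^ d * ((Fintype.card k : ℂ) * (if ∑ j, z j ^ 2 = 1 then 1 else 0) - 1) =
      ∑ ξ : Fin d → k, Sd ψ d ((∑ j, ξ j ^ 2) / 4) * ψ (∑ j, ξ j * z j) := by
  have e0 : (Fintype.card k : ℂ) * (if ∑ j, z j ^ 2 = 1 then 1 else 0) =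
      ∑ s, ψ (s * (∑ j, z j ^ 2 - 1)) := by
    rw [sum_shift ψ hψ]
    simp only [sub_eq_zero, mul_ite, mul_one, mul_zero]
  have e1 : (Fintype.card k : ℂ) * (if ∑ j, z j ^ 2 = 1 then 1 else 0) - 1 =
      ∑ s, if s = 0 then 0 else ψ (s * (∑ j, z j ^ 2 - 1)) := by
    rw [e0, ← Finset.add_sum_erase _ _ (Finset.mem_univ 0),
      ← Finset.add_sum_erase (f := fun s => if s = 0 then 0 else _) _ (Finset.mem_univ 0)]
    simp only [zero_mul, AddChar.map_zero_eq_one, if_true, zero_add, add_sub_cancel_left]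
    refine Finset.sum_congr rfl fun s hs => ?_
    rw [if_neg (Finset.ne_of_mem_erase hs)]
  rw [e1, Finset.mul_sum, ← Equiv.sum_comp (Equiv.neg k)]
  simp only [Sd, Finset.sum_mul]
  rw [Finset.sum_comm]
  refine Finset.sum_congr rfl fun s _ => ?_
  simp only [Equiv.neg_apply, neg_eq_zero]
  by_cases hs : s = 0
  · simp [hs]
  simp only [hs, if_false]
  have hs' : -s ≠ 0 := neg_ne_zero.2 hs
  have h := vec hF ψ hψ (-s) hs' d z
  rw [neg_neg] at h
  have e2 : ∀ ξ : Fin d → k, chi k s ^ d * ψ (s + (∑ j, ξ j ^ 2) / 4 / s) * ψ (∑ j, ξ j * z j) =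
      chi k s ^ d * ψ s * (ψ (∑ j, ξ j * z j) * ψ (-((∑ j, ξ j ^ 2) / (4 * -s)))) := by
    intro ξ
    rw [AddChar.map_add_eq_mul]
    have : -((∑ j, ξ j ^ 2) / (4 * -s)) = (∑ j, ξ j ^ 2) / 4 / s := by
      rw [mul_neg, div_neg, neg_neg, div_div]
    rw [this]; ring
  simp only [e2]
  rw [← Finset.mul_sum, h]
  have e3 : ψ (-s * (∑ j, z j ^ 2 - 1)) = ψ s * ψ (-s * ∑ j, z j ^ 2) := by
    rw [← AddChar.map_add_eq_mul]; congr 1; ring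
  have e4 : chi k s ^ d * chi k s ^ d = 1 := by rw [← mul_pow, chi_sq hs, one_pow]
  rw [e3, mul_pow]
  linear_combination (-(gs ψ ^ d * (ψ s * ψ (-s * ∑ j, z j ^ 2)))) * e4

/-- Fourier transform of an indicator function -/
noncomputable def ft (ψ : AddChar k ℂ) {d : ℕ} (G : Finset (Fin d → k)) (ξ : Fin d → k) : ℂ :=
  ∑ x ∈ G, ψ (∑ j, ξ j * x j)

lemma ft_conj (ψ : AddChar k ℂ) {d : ℕ} (G : Finset (Fin d → k)) (ξ : Fin d → k) :
    (starRingEnd ℂ) (ft ψ G ξ) = ∑ x ∈ G, ψ (-∑ j, ξ j * x j) := by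
  rw [ft, map_sum]
  refine Finset.sum_congr rfl fun x _ => ?_
  rw [AddChar.map_neg_eq_conj]

lemma orth (ψ : AddChar k ℂ) (hψ : ψ ≠ 1) {d : ℕ} (z : Fin d → k) :
    ∑ ξ : Fin d → k, ψ (∑ j, ξ j * z j) = if z = 0 then (Fintype.card k : ℂ) ^ d else 0 := by
  have h := Finset.prod_univ_sum (fun _ : Fin d => (Finset.univ : Finset k))
    (fun j t => ψ (t * z j))
  simp only [sum_shift ψ hψ, Fintype.piFinset_univ] at h
  rw [Finset.sum_congr rfl (g := fun ξ : Fin d → k => ∏ j, ψ (ξ j * z j))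
    (fun ξ _ => by rw [← char_sum]), ← h]
  split_ifs with hz
  · simp [hz]
  · obtain ⟨j, hj⟩ := Function.ne_iff.1 hz
    exact Finset.prod_eq_zero (Finset.mem_univ j) (if_neg hj)

lemma parseval (ψ : AddChar k ℂ) (hψ : ψ ≠ 1) {d : ℕ} (G : Finset (Fin d → k)) :
    ∑ ξ, ‖ft ψ G ξ‖ ^ 2 = (Fintype.card k : ℝ) ^ d * G.card := by
  have h : ∑ ξ, ft ψ G ξ * (starRingEnd ℂ) (ft ψ G ξ) = (Fintype.card k : ℂ) ^ d * G.card := by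
    simp only [ft_conj]
    simp only [ft, Finset.sum_mul_sum]
    rw [Finset.sum_comm]
    have : ∀ x ∈ G, ∑ ξ : Fin d → k, ∑ y ∈ G, ψ (∑ j, ξ j * x j) * ψ (-∑ j, ξ j * y j) =
        (Fintype.card k : ℂ) ^ d := by
      intro x hx
      rw [Finset.sum_comm, Finset.sum_eq_single x]
      · simp [← AddChar.map_add_eq_mul]
      · intro y _ hy
        have e : ∀ ξ : Fin d → k, ψ (∑ j, ξ j * x j) * ψ (-∑ j, ξ j * y j) =
            ψ (∑ j, ξ j * (x - y) j) := by
          intro ξ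
          rw [← AddChar.map_add_eq_mul, ← sub_eq_add_neg, ← Finset.sum_sub_distrib]
          simp only [Pi.sub_apply, mul_sub]
        simp only [e]
        rw [orth ψ hψ, if_neg (sub_ne_zero.2 hy.symm)]
      · exact fun h => absurd hx h
    rw [Finset.sum_congr rfl this, Finset.sum_const, nsmul_eq_mul, mul_comm]
  have h' : ((∑ ξ, ‖ft ψ G ξ‖ ^ 2 : ℝ) : ℂ) = (((Fintype.card k : ℝ) ^ d * G.card : ℝ) : ℂ) := by
    push_cast
    rw [← h]
    refine Finset.sum_congr rfl fun ξ _ => ?_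
    rw [Complex.mul_conj, Complex.normSq_eq_norm_sq]; push_cast; rfl
  exact_mod_cast h'

lemma mixing (hF : ringChar k ≠ 2) {d : ℕ} (G E : Finset (Fin d → k)) :
    |(Fintype.card k : ℝ) * ∑ x ∈ G, ((E.filter (fun y => ∑ j, (x j - y j) ^ 2 = 1)).card : ℝ) -
      G.card * E.card| ≤ 2 * √(Fintype.card k : ℝ) * √((Fintype.card k : ℝ) ^ d) *
        (√(G.card : ℝ) * √(E.card : ℝ)) := by
  obtain ⟨ψ, hψa⟩ := AddChar.exists_apply_ne_zero.2 (one_ne_zero (α := k))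
  have hψ : ψ ≠ 1 := AddChar.ne_one_iff.2 ⟨_, hψa⟩
  set q : ℝ := (Fintype.card k : ℝ) with hq
  have hq0 : 0 < q := by rw [hq]; exact_mod_cast Fintype.card_pos
  set R : ℝ := q * ∑ x ∈ G, ((E.filter (fun y => ∑ j, (x j - y j) ^ 2 = 1)).card : ℝ) -
      G.card * E.card with hR
  have h1 : gs ψ ^ d * (R : ℂ) = ∑ ξ : Fin d → k, Sd ψ d ((∑ j, ξ j ^ 2) / 4) *
      (ft ψ G ξ * (starRingEnd ℂ) (ft ψ E ξ)) := by
    have e1 : (R : ℂ) = ∑ x ∈ G, ∑ y ∈ E,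
        ((Fintype.card k : ℂ) * (if ∑ j, (x - y) j ^ 2 = 1 then 1 else 0) - 1) := by
      rw [hR]
      push_cast
      simp only [Finset.sum_sub_distrib, ← Finset.mul_sum, Finset.card_filter, Pi.sub_apply,
        Finset.sum_const, nsmul_eq_mul, mul_one]
      push_cast
      rw [hq]; push_cast; rfl
    rw [e1, Finset.mul_sum]
    simp only [Finset.mul_sum, kern hF ψ hψ]
    simp only [ft_conj]
    simp only [ft, Finset.sum_mul_sum]
    simp only [Finset.mul_sum]
    rw [Finset.sum_congr rfl (fun x _ => Finset.sum_comm), Finset.sum_comm]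
    refine Finset.sum_congr rfl fun ξ _ => Finset.sum_congr rfl fun x _ =>
      Finset.sum_congr rfl fun y _ => ?_
    rw [← AddChar.map_add_eq_mul, ← sub_eq_add_neg, ← Finset.sum_sub_distrib]
    simp only [Pi.sub_apply, mul_sub]
  have h2 := congrArg norm h1
  rw [norm_mul, norm_pow, gs_norm hF ψ hψ, Complex.norm_real, Real.norm_eq_abs, ← hq] at h2
  have h3 : √q ^ d * |R| ≤ 2 * √q * (√(q ^ d * G.card) * √(q ^ d * E.card)) := by
    rw [h2]
    refine (norm_sum_le _ _).trans ?_
    have e1 : ∀ ξ : Fin d → k, ‖Sd ψ d ((∑ j, ξ j ^ 2) / 4) *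
      (ft ψ G ξ * (starRingEnd ℂ) (ft ψ E ξ))‖ ≤ 2 * √q * (‖ft ψ G ξ‖ * ‖ft ψ E ξ‖) := by
      intro ξ
      rw [norm_mul, norm_mul, RCLike.norm_conj]
      exact mul_le_mul_of_nonneg_right (sd_bound hF ψ hψ d _) (by positivity)
    refine (Finset.sum_le_sum fun ξ _ => e1 ξ).trans ?_
    rw [← Finset.mul_sum]
    refine mul_le_mul_of_nonneg_left ?_ (by positivity)
    have := Real.sum_mul_le_sqrt_mul_sqrt Finset.univ (fun ξ => ‖ft ψ G ξ‖) (fun ξ => ‖ft ψ E ξ‖)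
    rwa [parseval ψ hψ, parseval ψ hψ] at this
  have h4 : √(q ^ d) = √q ^ d := by
    rw [Real.sqrt_eq_iff_mul_self_eq (by positivity) (by positivity), ← mul_pow,
      Real.mul_self_sqrt hq0.le]
  rw [Real.sqrt_mul (by positivity), Real.sqrt_mul (by positivity), h4] at h3
  rw [h4]
  have h5 : 0 < √q ^ d := by positivity
  refine le_of_mul_le_mul_left (h3.trans (le_of_eq ?_)) h5
  ring

end mix
end Kl
theorem statement14 {F : Type} [Field F] [Fintype F] [DecidableEq F]
    (q : ℕ) (hq : Fintype.card F = q) (hodd : Odd q)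
    (d : ℕ) (hd : 2 ≤ d)
    (E : Finset (Fin d → F)) (n : ℕ)
    (hE : (4 / Real.log 2) * (q : ℝ) ^ (((d : ℝ) + 1) / 2) ≤ (E.card : ℝ))
    (h : (Fin d → F) → ℕ)
    (hh : ∀ x, h x = (E.filter (fun y => ∑ j, (x j - y j) ^ 2 = 1)).card) :
    (E.card : ℝ) - 10 * (q : ℝ) ^ (((d : ℝ) + 1) / 2) - 2 * (q : ℝ) * (n : ℝ) ≤
      ((E.filter (fun x => n ≤ h x)).card : ℝ) := by
  have hF : ringChar F ≠ 2 := by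
    intro h2
    have := FiniteField.even_card_of_char_two h2
    rw [hq] at this
    obtain ⟨m, hm⟩ := hodd
    omega
  have hq0 : (0 : ℝ) < q := by rw [← hq]; exact_mod_cast Fintype.card_pos
  have hT : (q : ℝ) ^ (((d : ℝ) + 1) / 2) = √(q : ℝ) * √((q : ℝ) ^ d) := by
    rw [← Real.sqrt_mul hq0.le, Real.sqrt_eq_rpow, ← pow_succ', ← Real.rpow_natCast,
      ← Real.rpow_mul hq0.le]
    congr 1
    push_cast
    ring
  set G := E.filter (fun x => ¬ n ≤ h x) with hG
  have hmix := Kl.mixing hF G E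
  rw [hq] at hmix
  set T : ℝ := (q : ℝ) ^ (((d : ℝ) + 1) / 2) with hTdef
  have hT0 : 0 < T := by positivity
  have hsplit : (E.filter (fun x => n ≤ h x)).card + G.card = E.card :=
    Finset.card_filter_add_card_filter_not _
  have hsplit' : ((E.filter (fun x => n ≤ h x)).card : ℝ) + G.card = E.card := by
    exact_mod_cast hsplit
  have hGE : (G.card : ℝ) ≤ E.card := by exact_mod_cast Finset.card_filter_le _ _
  have hsum : ∑ x ∈ G, ((E.filter (fun y => ∑ j, (x j - y j) ^ 2 = 1)).card : ℝ) ≤ G.card * n := by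
    rw [← nsmul_eq_mul]
    refine Finset.sum_le_card_nsmul _ _ _ fun x hx => ?_
    rw [← hh x]
    have := (Finset.mem_filter.1 hx).2
    exact_mod_cast (not_le.1 this).le
  have hsq : √(G.card : ℝ) * √(E.card : ℝ) ≤ E.card := by
    calc √(G.card : ℝ) * √(E.card : ℝ) ≤ √(E.card : ℝ) * √(E.card : ℝ) :=
          mul_le_mul_of_nonneg_right (Real.sqrt_le_sqrt hGE) (Real.sqrt_nonneg _)
      _ = E.card := Real.mul_self_sqrt (Nat.cast_nonneg _)
  rw [mul_assoc 2, ← hT] at hmix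
  have h1 := (abs_le.1 hmix).1
  have h2 : 2 * T * (√(G.card : ℝ) * √(E.card : ℝ)) ≤ 2 * T * E.card :=
    mul_le_mul_of_nonneg_left hsq (by positivity)
  have h3 := mul_le_mul_of_nonneg_left hsum hq0.le
  have h4 : (G.card : ℝ) * E.card - 2 * T * E.card ≤ q * (G.card * n) := by linarith
  have hn0 : (0 : ℝ) ≤ n := Nat.cast_nonneg _
  suffices hB : (G.card : ℝ) ≤ 10 * T + 2 * q * n by linarith
  by_contra hcon
  push Not at hcon
  set B : ℝ := (G.card : ℝ)
  have hqn : 0 ≤ (q : ℝ) * n := by positivity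
  have h5 : (B - 2 * T) * B ≤ (B - 2 * T) * E.card :=
    mul_le_mul_of_nonneg_left hGE (by linarith)
  have hB0 : 0 < B := by linarith
  have h6 : (B - 2 * T) * B ≤ (q * n) * B := by nlinarith
  have h7 := le_of_mul_le_mul_right h6 hB0
  linarith
end

section
/- Let q be an odd prime power, d ≥ 2, and E ⊆ 𝔽_q^d with |E| ≥ (4/ln 2)·q^{(d+1)/2}. Then ∑_{x,y,z ∈ E} 𝟙[‖x−y‖ = 1]·𝟙[‖x−z‖ = 1] ≤ (|E|^3 + 6·q^{(d+1)/2}·|E|^2)/q^2; that is, the number of triples (x,y,z) ∈ E^3 with y and z both at distance 1 from x is at most (|E|^3 + 6·q^{(d+1)/2}·|E|^2)/q^2. -/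
open Polynomial in
lemma aux_sqfree {K : Type} [Field K] (F : K[X]) (hsq : Squarefree F) (hdeg : 0 < F.natDegree)
    (c : K) (hc : c ≠ 0) : ∀ (n : ℕ) (r s : K[X]), s.natDegree ≤ n → r ^ 2 = C c * F * s ^ 2 →
    s = 0 := by
  intro n
  induction n using Nat.strong_induction_on with
  | _ n ih =>
    intro r s hn h
    by_contra hs
    have hF0 : F ≠ 0 := by rintro rfl; simp at hdeg
    have h1 : F ∣ r := by
      have : F ∣ r ^ 2 := by rw [h]; exact ⟨C c * s ^ 2, by ring⟩
      exact hsq.isRadical 2 r this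
    obtain ⟨r1, rfl⟩ := h1
    have h2 : F * r1 ^ 2 = C c * s ^ 2 := by
      apply mul_left_cancel₀ hF0
      linear_combination h
    have h3 : F ∣ s := by
      have : F ∣ s ^ 2 := by
        refine ⟨C c⁻¹ * r1 ^ 2, ?_⟩
        have : C c⁻¹ * C c = (1 : K[X]) := by rw [← C_mul, inv_mul_cancel₀ hc, C_1]
        linear_combination (-s^2) * this - C c⁻¹ * h2
      exact hsq.isRadical 2 s this
    obtain ⟨s1, rfl⟩ := h3
    have hs1 : s1 ≠ 0 := by rintro rfl; simp at hs
    rw [natDegree_mul hF0 hs1] at hn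
    refine hs1 (ih s1.natDegree (by omega) r1 s1 le_rfl ?_)
    apply mul_left_cancel₀ hF0
    linear_combination h2

open Polynomial in
lemma aux_indep {K : Type} [Field K] (p e L a q : ℕ) [Fact p.Prime] [CharP K p] (hL : L = p ^ e)
    (hodd : Odd L) (F : K[X]) (hF0 : F.coeff 0 ≠ 0) (hsq : Squarefree F) (hdeg : F.natDegree = 2 * q)
    (hq : 0 < q) (r s : K[X]) (hr : r.natDegree < a) (hs : s.natDegree < a) (ha : 2 * a + 2 * q ≤ L + 1)
    (h : X ^ L ∣ r + s * F ^ ((L + 1) / 2)) : r = 0 ∧ s = 0 := by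
  have hFne : F ≠ 0 := by rintro rfl; simp at hF0
  have h1 : X ^ L ∣ r ^ 2 - s ^ 2 * F * F ^ L := by
    obtain ⟨w, hw⟩ := h
    refine ⟨w * (r - s * F ^ ((L + 1) / 2)), ?_⟩
    obtain ⟨k, hk⟩ := hodd
    have : (L + 1) / 2 = k + 1 := by omega
    rw [this] at hw ⊢
    have e2 : F ^ L = F ^ (2 * k + 1) := by rw [hk]
    rw [e2]
    linear_combination (r - s * F ^ (k + 1)) * hw
  have h2 : X ^ L ∣ F ^ L - C (F.coeff 0 ^ L) := by
    have : F ^ L - C (F.coeff 0 ^ L) = (F - C (F.coeff 0)) ^ L := by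
      rw [hL, sub_pow_char_pow]; simp
    rw [this]
    apply pow_dvd_pow_of_dvd
    rw [X_dvd_iff]; simp
  have h3 : X ^ L ∣ r ^ 2 - C (F.coeff 0 ^ L) * F * s ^ 2 := by
    have := dvd_add h1 (h2.mul_left (s ^ 2 * F))
    convert this using 1; ring
  have h4 : r ^ 2 - C (F.coeff 0 ^ L) * F * s ^ 2 = 0 := by
    apply eq_zero_of_dvd_of_natDegree_lt h3
    rw [natDegree_X_pow]
    refine (natDegree_sub_le _ _).trans_lt (max_lt ?_ ?_)
    · rw [natDegree_pow]; omega
    · refine (natDegree_mul_le.trans (Nat.add_le_add_right natDegree_mul_le _)).trans_lt ?_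
      rw [natDegree_pow, natDegree_C, hdeg]; omega
  have h5 : s = 0 := aux_sqfree F hsq (by omega) (F.coeff 0 ^ L) (pow_ne_zero _ hF0) _ r s le_rfl
    (by linear_combination h4)
  subst h5
  simp at h4
  exact ⟨h4, rfl⟩

open Polynomial in
lemma stepanov {K : Type} [Field K] [Fintype K] [DecidableEq K] (p e L a b q : ℕ) [Fact p.Prime] [CharP K p]
    (hL : L = p ^ e) (hQ : Fintype.card K = L ^ 2)
    (hodd : Odd L) (F : K[X]) (hF0 : F.coeff 0 ≠ 0) (hsq : Squarefree F) (hdeg : F.natDegree = 2 * q)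
    (hq : 0 < q) (ha : 2 * a + 2 * q ≤ L + 1) (ha0 : 0 < a)
    (hb : a * L + b + q * (L + 1) < 2 * a * b) (ε : K) :
    (Finset.univ.filter fun x : K => (F.eval x) ^ ((L ^ 2 - 1) / 2) = ε ∧ F.eval x ≠ 0).card
      ≤ a + b * L + q * (L + 1) := by
  classical
  set H := F ^ ((L + 1) / 2) with hH
  set M := a * L + b + q * (L + 1) with hM
  have hLpos : 0 < L := hodd.pos
  have hHdeg : H.natDegree = q * (L + 1) := by
    obtain ⟨k, hk⟩ := hodd
    rw [hH, natDegree_pow, hdeg, show (L + 1) / 2 = k + 1 by omega, hk]; ring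
  let Φ : (Fin b → K[X]) → (Fin b → K[X]) → K[X] := fun r s =>
    ∑ j : Fin b, X ^ (j : ℕ) * ((r j) ^ L + C ε * (s j) ^ L * H)
  have hΦ : ∀ r s r' s', Φ r s - Φ r' s' = Φ (r - r') (s - s') := by
    intro r s r' s'
    simp only [Φ, ← Finset.sum_sub_distrib, Pi.sub_apply]
    refine Finset.sum_congr rfl fun j _ => ?_
    rw [hL, sub_pow_char_pow, sub_pow_char_pow]; ring
  have hdL : ∀ u : K[X], u ∈ degreeLT K a → u.natDegree < a := by
    intro u hu
    rw [mem_degreeLT] at hu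
    by_cases h0 : u = 0
    · simpa [h0] using ha0
    · exact (natDegree_lt_iff_degree_lt h0).2 hu
  have hΦd : ∀ r s : Fin b → degreeLT K a, Φ (fun j => (r j : K[X])) (fun j => (s j : K[X])) ∈ degreeLT K M := by
    intro r s
    refine Submodule.sum_mem _ fun j _ => ?_
    rw [mem_degreeLT]
    refine degree_le_natDegree.trans_lt (Nat.cast_lt.2 ?_)
    have h1 := hdL _ (r j).2
    have h2 := hdL _ (s j).2
    have h3 : (((r j : K[X])) ^ L + C ε * (s j : K[X]) ^ L * H).natDegree ≤ a * L + q * (L + 1) := by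
      refine (natDegree_add_le _ _).trans (max_le ?_ ?_)
      · rw [natDegree_pow]; nlinarith
      · refine natDegree_mul_le.trans ?_
        rw [hHdeg]
        refine Nat.add_le_add_right (natDegree_mul_le.trans ?_) _
        rw [natDegree_C, natDegree_pow]; nlinarith
    beta_reduce
    refine natDegree_mul_le.trans_lt ?_
    rw [natDegree_X_pow]
    have := j.2
    omega
  let D := (Fin b → degreeLT K a) × (Fin b → degreeLT K a)
  let Ψ : D → degreeLT K M := fun x => ⟨_, hΦd x.1 x.2⟩
  have hcardLT : ∀ n, Nat.card (degreeLT K n) = (L ^ 2) ^ n := by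
    intro n
    rw [Nat.card_congr (degreeLTEquiv K n).toEquiv]
    simp [hQ]
  have hfin : ∀ n, Finite (degreeLT K n) := fun n => Finite.of_equiv _ (degreeLTEquiv K n).symm.toEquiv
  have := hfin a
  have := hfin M
  have hL1 : 1 < L ^ 2 := by rw [← hQ]; exact Fintype.one_lt_card
  have hninj : ¬ Function.Injective Ψ := by
    intro hinj
    have := Nat.card_le_card_of_injective Ψ hinj
    rw [hcardLT, Nat.card_prod, Nat.card_fun, hcardLT, Nat.card_eq_fintype_card, Fintype.card_fin,
      ← pow_mul, ← pow_add] at this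
    have := (Nat.pow_le_pow_iff_right hL1).1 this
    have e1 : a * b + a * b = 2 * a * b := by ring
    omega
  obtain ⟨⟨r1, s1⟩, ⟨r2, s2⟩, hΨ, hne⟩ : ∃ x y, Ψ x = Ψ y ∧ x ≠ y := by
    simpa [Function.Injective] using hninj
  let r : Fin b → K[X] := fun j => ((r1 - r2) j : degreeLT K a)
  let s : Fin b → K[X] := fun j => ((s1 - s2) j : degreeLT K a)
  have hrs : Φ r s = 0 := by
    have h1 : Φ (fun j => (r1 j : K[X])) (fun j => (s1 j : K[X])) = Φ (fun j => (r2 j : K[X])) (fun j => (s2 j : K[X])) :=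
      congrArg Subtype.val hΨ
    have := hΦ (fun j => (r1 j : K[X])) (fun j => (s1 j : K[X])) (fun j => (r2 j : K[X])) (fun j => (s2 j : K[X]))
    rw [h1, sub_self] at this
    exact this.symm
  let Z : K[X] := ∑ j : Fin b, X ^ ((j : ℕ) * L) * (r j + s j * H)
  have hZ : Z ≠ 0 := by
    intro hZ0
    have key : ∀ n : ℕ, ∀ j : Fin b, (j : ℕ) = n → r j = 0 ∧ s j = 0 := by
      intro n
      induction n using Nat.strong_induction_on with
      | _ n ih =>
        intro j hj
        apply aux_indep p e L a q hL hodd F hF0 hsq hdeg hq (r j) (s j) (hdL _ ((r1 - r2) j).2)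
          (hdL _ ((s1 - s2) j).2) ha
        have h1 : X ^ ((n + 1) * L) ∣ ∑ i ∈ Finset.univ.erase j, X ^ ((i : ℕ) * L) * (r i + s i * H) := by
          refine Finset.dvd_sum fun i hi => ?_
          rcases lt_trichotomy (i : ℕ) n with h | h | h
          · obtain ⟨h2, h3⟩ := ih i h i rfl
            simp [h2, h3]
          · exact absurd (Fin.ext (h.trans hj.symm)) (Finset.ne_of_mem_erase hi)
          · exact (pow_dvd_pow _ (Nat.mul_le_mul_right _ h)).mul_right _
        have h2 : X ^ ((n + 1) * L) ∣ X ^ (n * L) * (r j + s j * H) := by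
          have : X ^ (n * L) * (r j + s j * H) = - ∑ i ∈ Finset.univ.erase j, X ^ ((i : ℕ) * L) * (r i + s i * H) := by
            have := Finset.add_sum_erase Finset.univ (fun i : Fin b => X ^ ((i : ℕ) * L) * (r i + s i * H)) (Finset.mem_univ j)
            rw [← hj]
            rw [eq_neg_iff_add_eq_zero]
            exact this.trans hZ0
          rw [this]; exact (dvd_neg).2 h1
        rw [add_mul, one_mul, pow_add] at h2
        exact (mul_dvd_mul_iff_left (pow_ne_zero _ X_ne_zero)).1 h2
    apply hne
    rw [Prod.mk.injEq]
    constructor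
    · funext j
      have := (key _ j rfl).1
      have h3 : (r1 - r2) j = 0 := Subtype.ext this
      exact sub_eq_zero.1 h3
    · funext j
      have := (key _ j rfl).2
      have h3 : (s1 - s2) j = 0 := Subtype.ext this
      exact sub_eq_zero.1 h3
  have hZd : Z.natDegree ≤ a + b * L + q * (L + 1) := by
    refine natDegree_sum_le_of_forall_le _ _ fun j _ => ?_
    have h1 : (r j).natDegree < a := hdL _ ((r1 - r2) j).2
    have h2 : (s j).natDegree < a := hdL _ ((s1 - s2) j).2
    have h3 : (r j + s j * H).natDegree ≤ a + q * (L + 1) := by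
      refine (natDegree_add_le _ _).trans (max_le (by omega) ?_)
      refine natDegree_mul_le.trans ?_
      rw [hHdeg]; omega
    refine natDegree_mul_le.trans ?_
    rw [natDegree_X_pow]
    have : (j : ℕ) * L ≤ b * L := Nat.mul_le_mul_right _ j.2.le
    omega
  refine le_trans ?_ hZd
  by_contra hlt
  push Not at hlt
  apply hZ
  refine eq_zero_of_natDegree_lt_card_of_eval_eq_zero' Z _ (fun x hx => ?_) hlt
  simp only [Finset.mem_filter, Finset.mem_univ, true_and] at hx
  have hxQ : x ^ (L * L) = x := by rw [← pow_two, ← hQ, FiniteField.pow_card]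
  have hHx : (H.eval x) ^ L = ε * H.eval x := by
    rw [hH, eval_pow, ← hx.1, ← pow_mul, ← pow_add]
    congr 1
    obtain ⟨k, hk⟩ := hodd
    have e1 : (L + 1) / 2 = k + 1 := by omega
    have e2 : (L ^ 2 - 1) / 2 = 2 * k ^ 2 + 2 * k := by
      have : L ^ 2 = 2 * (2 * k ^ 2 + 2 * k) + 1 := by rw [hk]; ring
      omega
    rw [e1, e2, hk]; ring
  have : (Z.eval x) ^ L = (Φ r s).eval x := by
    simp only [Z, Φ, eval_finsetSum]
    rw [hL, sum_pow_char_pow, ← hL]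
    refine Finset.sum_congr rfl fun j _ => ?_
    simp only [eval_mul, eval_pow, eval_X, eval_add, eval_C]
    rw [mul_pow, ← pow_mul, mul_assoc, mul_comm (j : ℕ), pow_mul, hxQ, hL, add_pow_char_pow, ← hL,
      mul_pow, hHx]
    ring
  rw [hrs, eval_zero] at this
  exact pow_eq_zero_iff hLpos.ne' |>.1 this

open Polynomial in
lemma stepanov_app {K : Type} [Field K] [Fintype K] [DecidableEq K] (p e L q : ℕ) [Fact p.Prime] [CharP K p]
    (hL : L = p ^ e) (hQ : Fintype.card K = L ^ 2) (hodd : Odd L) (hq : 2 ≤ q) (hqK : (q : K) = 0)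
    (b : K) (hb : b ≠ 0) (hLq : 4 * q < L) :
    -((8 * q + 6 : ℤ) * L) ≤ ∑ y : K, quadraticChar K ((y ^ q - y) ^ 2 - 4 * b) := by
  have hchar : ringChar K ≠ 2 := by
    intro h
    have := FiniteField.even_card_of_char_two h
    rw [hQ] at this
    have h2 : Odd (L ^ 2) := hodd.pow
    rw [Nat.odd_iff] at h2; omega
  have h2K : (2 : K) ≠ 0 := Ring.two_ne_zero hchar
  have h4b : 4 * b ≠ 0 := by
    have : (4 : K) = 2 * 2 := by norm_num
    rw [this]; exact mul_ne_zero (mul_ne_zero h2K h2K) hb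
  set F : K[X] := (X ^ q - X) ^ 2 - C (4 * b) with hF
  have hdX : (X ^ q - X : K[X]).natDegree = q := FiniteField.X_pow_card_sub_X_natDegree_eq K (by omega)
  have hdeg : F.natDegree = 2 * q := by
    rw [hF, natDegree_sub_C, natDegree_pow, hdX]
  have hF0 : F.coeff 0 ≠ 0 := by
    rw [coeff_zero_eq_eval_zero, hF]
    simp [show q ≠ 0 by omega]
    rw [show (4 : K) = 2 * 2 by norm_num]
    exact ⟨by simpa using h2K, hb⟩
  have hsq : Squarefree F := by
    apply Separable.squarefree
    rw [separable_def]
    have hd : derivative F = C (-2) * (X ^ q - X) := by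
      rw [hF]
      simp only [derivative_sub, derivative_pow, derivative_C, derivative_X, hqK]
      simp
    refine ⟨C (-(4 * b)⁻¹), C (-(4 * b)⁻¹) * C (2⁻¹) * (X ^ q - X), ?_⟩
    rw [hd, hF]
    have e1 : (C (-(4 * b)⁻¹) : K[X]) * C (4 * b) = -1 := by
      rw [← C_mul, neg_mul, inv_mul_cancel₀ h4b]; simp
    have e2 : (C (2⁻¹) : K[X]) * C (-2) = -1 := by
      rw [← C_mul, mul_neg, inv_mul_cancel₀ h2K]; simp
    linear_combination -e1 + C (-(4 * b)⁻¹) * (X ^ q - X) ^ 2 * e2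
  obtain ⟨k, hk⟩ := hodd
  have hst := stepanov p e L (k + 1 - q) (k + 1 + (2 * q + 1)) q hL hQ ⟨k, hk⟩ F hF0 hsq hdeg (by omega) (by omega)
    (by omega) (by
      obtain ⟨m, hm⟩ : ∃ m, k = q + m := ⟨k - q, by omega⟩
      have : k + 1 - q = m + 1 := by omega
      rw [this, hk, hm]
      have : q ≤ m := by omega
      obtain ⟨n, rfl⟩ : ∃ n, m = q + n := ⟨m - q, by omega⟩
      ring_nf
      nlinarith) (-1)
  set N := (Finset.univ.filter fun x : K => (F.eval x) ^ ((L ^ 2 - 1) / 2) = -1 ∧ F.eval x ≠ 0) with hN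
  have hev : ∀ y : K, F.eval y = (y ^ q - y) ^ 2 - 4 * b := by intro y; simp [hF]
  set N0 := (Finset.univ.filter fun x : K => F.eval x = 0) with hN0
  have hFne : F ≠ 0 := by rintro h; rw [h] at hF0; simp at hF0
  have hN0c : N0.card ≤ 2 * q := by
    rw [← hdeg]
    apply card_le_degree_of_subset_roots
    intro x hx
    have : x ∈ N0 := hx
    simp only [hN0, Finset.mem_filter] at this
    rw [mem_roots hFne]; exact this.2
  have hpt : ∀ y : K, (1 : ℤ) - (if y ∈ N0 then 1 else 0) - 2 * (if y ∈ N then 1 else 0) ≤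
      quadraticChar K ((y ^ q - y) ^ 2 - 4 * b) := by
    intro y
    rw [← hev]
    by_cases h0 : F.eval y = 0
    · have : y ∈ N0 := by simp [hN0, h0]
      rw [if_pos this, h0]
      simp only [quadraticChar_zero]
      split_ifs <;> norm_num
    · have hy0 : y ∉ N0 := by simp [hN0, h0]
      rw [if_neg hy0]
      rcases quadraticChar_dichotomy h0 with h | h
      · rw [h]; split_ifs <;> norm_num
      · have : y ∈ N := by
          simp only [hN, Finset.mem_filter, Finset.mem_univ, true_and]
          refine ⟨?_, h0⟩
          have h5 := quadraticChar_eq_pow_of_char_ne_two' hchar (F.eval y)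
          rw [h, hQ] at h5
          have h6 : L ^ 2 / 2 = (L ^ 2 - 1) / 2 := by
            have : L ^ 2 = 2 * (2 * k ^ 2 + 2 * k) + 1 := by rw [hk]; ring
            omega
          rw [← h6, ← h5]; simp
        rw [if_pos this, h]; norm_num
  refine le_trans ?_ (Finset.sum_le_sum fun y _ => hpt y)
  rw [Finset.sum_sub_distrib, Finset.sum_sub_distrib, ← Finset.mul_sum, Finset.sum_boole, Finset.sum_boole]
  simp only [Finset.filter_mem_eq_inter, Finset.univ_inter, Finset.sum_const, Finset.card_univ, hQ]
  have e3 : ((k + 1 - q : ℕ) : ℤ) = k + 1 - q := by push_cast [show q ≤ k + 1 by omega]; ring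
  zify at hst hN0c
  rw [e3] at hst
  zify at hk
  have hk' : (2 * k : ℤ) = L - 1 := by omega
  have hL1 : (1 : ℤ) ≤ L := by omega
  have hq0 : (0 : ℤ) ≤ q := by omega
  push_cast
  simp only [nsmul_eq_mul]
  push_cast
  nlinarith

open Finset in
lemma root_count {K : Type} [Field K] [Fintype K] [DecidableEq K] (hK : ringChar K ≠ 2)
    (b : K) (hb : b ≠ 0) (g : K → ℂ) :
    ∑ x ∈ univ.erase (0 : K), g (x + b * x⁻¹) = ∑ z : K, g z * (1 + (quadraticChar K (z ^ 2 - 4 * b) : ℂ)) := by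
  have h2 : (2 : K) ≠ 0 := Ring.two_ne_zero hK
  have h1 : ∀ z : K, g z * (1 + (quadraticChar K (z ^ 2 - 4 * b) : ℂ)) =
      ∑ w : K, if w ^ 2 = z ^ 2 - 4 * b then g z else 0 := by
    intro z
    have := quadraticChar_card_sqrts hK (z ^ 2 - 4 * b)
    rw [← Finset.sum_filter, Finset.sum_const, nsmul_eq_mul, mul_comm]
    congr 1
    have h3 : ((univ.filter fun w : K => w ^ 2 = z ^ 2 - 4 * b).card : ℤ) = quadraticChar K (z ^ 2 - 4 * b) + 1 := by
      rw [← this]; congr 2; ext; simp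
    have h4 : (((univ.filter fun w : K => w ^ 2 = z ^ 2 - 4 * b).card : ℤ) : ℂ) = ((quadraticChar K (z ^ 2 - 4 * b) + 1 : ℤ) : ℂ) := by rw [h3]
    push_cast at h4
    rw [h4]; ring
  rw [Finset.sum_congr rfl fun z _ => h1 z, ← Finset.sum_product', ← Finset.sum_filter]
  refine Finset.sum_nbij' (fun x => (x + b * x⁻¹, x - b * x⁻¹)) (fun p => (p.1 + p.2) / 2) ?_ ?_ ?_ ?_ ?_
  · intro x hx
    have hx : x ≠ 0 := by simpa using hx
    simp
    field_simp; ring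
  · rintro ⟨z, w⟩ h
    simp at h ⊢
    refine ⟨?_, h2⟩
    intro h0
    have h4 : (4 : K) = 2 * 2 := by norm_num
    have : 2 * 2 * b = 0 := by rw [← h4]; linear_combination (z - w) * h0 + h
    simp [h2, hb] at this
  · intro x hx
    simp; field_simp; ring
  · rintro ⟨z, w⟩ h
    simp at h
    have h4 : (4 : K) = 2 * 2 := by norm_num
    have hne : z + w ≠ 0 := by
      intro h0
      have : 2 * 2 * b = 0 := by rw [← h4]; linear_combination (z - w) * h0 + h
      simp [h2, hb] at this
    have e : b * ((z + w) / 2)⁻¹ = (z - w) / 2 := by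
      field_simp; linear_combination h
    simp only [e, Prod.mk.injEq]
    constructor <;> field_simp <;> ring
  · intro x hx; rfl

/-- Kloosterman-type sum of a function `φ` (the term `x = 0` is removed). -/
noncomputable def Kl {K : Type} [Field K] [Fintype K] (φ : K → ℂ) (b : K) : ℂ :=
  (∑ x : K, φ (x + b * x⁻¹)) - φ 0

lemma Kl_eq {K : Type} [Field K] [Fintype K] [DecidableEq K] (φ : K → ℂ) (b : K) :
    Kl φ b = ∑ x ∈ Finset.univ.erase (0 : K), φ (x + b * x⁻¹) := by
  rw [Kl, ← Finset.add_sum_erase Finset.univ _ (Finset.mem_univ (0 : K))]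
  simp

open Finset in
lemma Kl_sq {K : Type} [Field K] [Fintype K] [DecidableEq K] (hK : ringChar K ≠ 2)
    (ψ : AddChar K ℂ) (b : K) :
    Kl ψ b ^ 2 = ∑ n ∈ univ.erase (0 : K), ∑ s : K, ψ (s + b * s * n⁻¹) * (1 + (quadraticChar K (s ^ 2 - 4 * n) : ℂ)) := by
  rw [Kl_eq, pow_two, Finset.sum_mul_sum]
  have : ∀ n ∈ univ.erase (0 : K), ∑ s : K, ψ (s + b * s * n⁻¹) * (1 + (quadraticChar K (s ^ 2 - 4 * n) : ℂ)) =
      ∑ x ∈ univ.erase (0 : K), ψ ((x + n * x⁻¹) + b * (x + n * x⁻¹) * n⁻¹) := by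
    intro n hn
    rw [root_count hK n (by simpa using hn) (fun s => ψ (s + b * s * n⁻¹))]
  rw [Finset.sum_congr rfl this]
  conv_rhs => rw [Finset.sum_comm]
  refine Finset.sum_congr rfl fun x hx => ?_
  have hx : x ≠ 0 := by simpa using hx
  refine Finset.sum_nbij' (fun y => x * y) (fun n => n * x⁻¹) ?_ ?_ ?_ ?_ ?_
  · intro y hy
    simp at hy ⊢; exact ⟨hx, hy⟩
  · intro y hy
    simp at hy ⊢; exact ⟨hy, hx⟩
  · intro y hy; field_simp
  · intro y hy; field_simp
  · intro y hy
    have hy : y ≠ 0 := by simpa using hy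
    rw [← AddChar.map_add_eq_mul]
    congr 1
    field_simp
    ring

instance {K : Type} [Fintype K] (a b : K) : Fintype (QuadraticAlgebra K a b) :=
  Fintype.ofEquiv _ (QuadraticAlgebra.equivProd a b).symm

open Finset in
lemma Kl_ext {K : Type} [Field K] [Fintype K] [DecidableEq K] (hK : ringChar K ≠ 2)
    (ν : K) (hν : quadraticChar K ν = -1) [Fact (∀ r : K, r ^ 2 ≠ ν + 0 * r)] (ψ : AddChar K ℂ) (b : K) :
    Kl (K := QuadraticAlgebra K ν 0) (fun z => ψ (2 * z.re)) (algebraMap K _ b) =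
     ∑ n ∈ univ.erase (0 : K), ∑ s : K, ψ (s + b * s * n⁻¹) * (1 - (quadraticChar K (s ^ 2 - 4 * n) : ℂ)) := by
  classical
  have h2 : (2 : K) ≠ 0 := Ring.two_ne_zero hK
  have hν0 : ν ≠ 0 := by rintro rfl; simp at hν
  have h1 : ∀ n s : K, ψ (s + b * s * n⁻¹) * (1 - (quadraticChar K (s ^ 2 - 4 * n) : ℂ)) =
      ∑ w : K, if w ^ 2 = ν * (s ^ 2 - 4 * n) then ψ (s + b * s * n⁻¹) else 0 := by
    intro n s
    have := quadraticChar_card_sqrts hK (ν * (s ^ 2 - 4 * n))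
    rw [← Finset.sum_filter, Finset.sum_const, nsmul_eq_mul, mul_comm]
    congr 1
    have h3 : ((univ.filter fun w : K => w ^ 2 = ν * (s ^ 2 - 4 * n)).card : ℤ) = -quadraticChar K (s ^ 2 - 4 * n) + 1 := by
      rw [map_mul, hν] at this
      rw [← neg_one_mul, ← this]; congr 2; ext; simp
    have h4 := congrArg (Int.cast : ℤ → ℂ) h3
    push_cast at h4
    rw [h4]; ring
  rw [Finset.sum_congr rfl fun n _ => Finset.sum_congr rfl fun s _ => h1 n s, Kl_eq]
  have h5 : ∑ n ∈ univ.erase (0 : K), ∑ s : K, ∑ w : K,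
      (if w ^ 2 = ν * (s ^ 2 - 4 * n) then ψ (s + b * s * n⁻¹) else 0) =
      ∑ n ∈ univ.erase (0 : K), ∑ t : K × K,
      (if t.2 ^ 2 = ν * (t.1 ^ 2 - 4 * n) then ψ (t.1 + b * t.1 * n⁻¹) else 0) := by
    refine Finset.sum_congr rfl fun n _ => ?_
    rw [Fintype.sum_prod_type]
  rw [h5, ← Finset.sum_product', ← Finset.sum_filter]
  refine Finset.sum_nbij' (fun z => (QuadraticAlgebra.norm z, (2 * z.re, 2 * ν * z.im)))
    (fun p => ⟨p.2.1 / 2, p.2.2 / (2 * ν)⟩) ?_ ?_ ?_ ?_ ?_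
  · intro z hz
    have hz : z ≠ 0 := by simpa using hz
    have : QuadraticAlgebra.norm z ≠ 0 := by
      rw [Ne, QuadraticAlgebra.norm_eq_zero_iff_eq_zero]; exact hz
    simp only [mem_filter, mem_product, mem_erase, mem_univ, and_true]
    refine ⟨this, ?_⟩
    rw [QuadraticAlgebra.norm_def]; ring
  · rintro ⟨n, s, w⟩ h
    simp only [mem_filter, mem_product, mem_erase, mem_univ, and_true] at h ⊢
    intro h0
    have e1 := congrArg QuadraticAlgebra.re h0
    have e2 := congrArg QuadraticAlgebra.im h0
    simp [h2, hν0] at e1 e2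
    rw [e1, e2] at h
    have h4 : (4 : K) = 2 * 2 := by norm_num
    have h6 := h.2
    rw [h4] at h6
    simp [h2, hν0] at h6
    exact h.1 h6
  · intro z hz
    ext
    · simp; field_simp
    · simp; field_simp
  · rintro ⟨n, s, w⟩ h
    simp only [mem_filter, mem_product, mem_erase, mem_univ, and_true] at h
    have h4 : (4 : K) = 2 * 2 := by norm_num
    simp only [Prod.mk.injEq, QuadraticAlgebra.norm_def]
    refine ⟨?_, ?_, ?_⟩
    · field_simp
      rw [h4] at h
      linear_combination (-1 : K) * h.2
    · field_simp
    · field_simp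
  · intro z hz
    have hz : z ≠ 0 := by simpa using hz
    congr 1
    have : (algebraMap K (QuadraticAlgebra K ν 0) b * z⁻¹).re = b * (z.re * (QuadraticAlgebra.norm z)⁻¹) := by
      simp [QuadraticAlgebra.re_inv]
      left; ring
    rw [QuadraticAlgebra.re_add, this]; ring

open Finset in
lemma Kl_step {K : Type} [Field K] [Fintype K] [DecidableEq K] (hK : ringChar K ≠ 2)
    (ν : K) (hν : quadraticChar K ν = -1) [Fact (∀ r : K, r ^ 2 ≠ ν + 0 * r)] (ψ : AddChar K ℂ) (hψ : ψ ≠ 1)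
    (b : K) (hb : b ≠ 0) :
    Kl (K := QuadraticAlgebra K ν 0) (fun z => ψ (2 * z.re)) (algebraMap K _ b) =
     2 * Fintype.card K - Kl ψ b ^ 2 := by
  rw [eq_sub_iff_add_eq, Kl_ext hK ν hν, Kl_sq hK, ← Finset.sum_add_distrib]
  have : ∀ n ∈ univ.erase (0 : K), (∑ s : K, ψ (s + b * s * n⁻¹) * (1 - (quadraticChar K (s ^ 2 - 4 * n) : ℂ)) +
      ∑ s : K, ψ (s + b * s * n⁻¹) * (1 + (quadraticChar K (s ^ 2 - 4 * n) : ℂ))) =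
      if n = -b then 2 * (Fintype.card K : ℂ) else 0 := by
    intro n hn
    have hn : n ≠ 0 := by simpa using hn
    have h1 := AddChar.sum_mulShift (1 + b * n⁻¹) (AddChar.IsPrimitive.of_ne_one hψ)
    have h2 : (1 + b * n⁻¹ = 0) ↔ n = -b := by
      rw [← mul_left_inj' hn]
      field_simp
      rw [mul_zero, eq_neg_iff_add_eq_zero]
    rw [← Finset.sum_add_distrib]
    simp only [h2] at h1
    have h3 : ∀ s : K, ψ (s + b * s * n⁻¹) * (1 - (quadraticChar K (s ^ 2 - 4 * n) : ℂ)) +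
      ψ (s + b * s * n⁻¹) * (1 + (quadraticChar K (s ^ 2 - 4 * n) : ℂ)) = 2 * ψ (s * (1 + b * n⁻¹)) := by
      intro s
      rw [show s * (1 + b * n⁻¹) = s + b * s * n⁻¹ by ring]; ring
    rw [Finset.sum_congr rfl fun s _ => h3 s, ← Finset.mul_sum, h1]
    split_ifs <;> simp
  rw [Finset.sum_congr rfl this, Finset.sum_ite_eq', if_pos]
  simpa using hb

/-- The recursion followed by Kloosterman sums in a tower of quadratic extensions. -/
def Tk {R : Type} [CommRing R] (q : ℕ) : ℕ → R → R
  | 0, x => x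
  | (k + 1), x => 2 * (q : R) ^ (2 ^ k) - (Tk q k x) ^ 2

lemma Tk_cast (q k : ℕ) (x : ℝ) : ((Tk q k x : ℝ) : ℂ) = Tk q k (x : ℂ) := by
  induction k with
  | zero => rfl
  | succ k ih => simp only [Tk]; push_cast; rw [ih]

lemma ringChar_ne_two_of_odd {K : Type} [Field K] [Fintype K] (h : Odd (Fintype.card K)) : ringChar K ≠ 2 := by
  intro h2
  have := FiniteField.even_card_of_char_two h2
  rw [Nat.odd_iff] at h; omega

lemma tower {F : Type} [Field F] [Fintype F] (q : ℕ) (hq : Fintype.card F = q) (hodd : Odd q) :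
    ∀ k : ℕ, ∃ (K : Type) (_ : Field K) (_ : Fintype K) (i : F →+* K) (tr : K →+ F),
      Fintype.card K = q ^ (2 ^ k) ∧ Function.Surjective tr ∧ (∀ c z, tr (i c * z) = c * tr z) ∧
      (∀ y, tr (y ^ q) = tr y) ∧ ∀ ψ : AddChar F ℂ, ψ ≠ 1 → ∀ b : F, b ≠ 0 →
        Kl (fun z => ψ (tr z)) (i b) = Tk q k (Kl ψ b) := by
  intro k
  have hF2 : ringChar F ≠ 2 := ringChar_ne_two_of_odd (by rw [hq]; exact hodd)
  induction k with
  | zero =>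
    refine ⟨F, inferInstance, inferInstance, RingHom.id F, AddMonoidHom.id F, by simp [hq],
      Function.surjective_id, by simp, ?_, ?_⟩
    · intro y; simp [← hq, FiniteField.pow_card]
    · intro ψ _ b _; rfl
  | succ k ih =>
    classical
    obtain ⟨K, _, _, i, tr, hcard, hsurj, hlin, hfrob, hKl⟩ := ih
    have hK2 : ringChar K ≠ 2 := ringChar_ne_two_of_odd (by rw [hcard]; exact hodd.pow)
    obtain ⟨ν, hν⟩ := quadraticChar_exists_neg_one hK2
    have hfact : Fact (∀ r : K, r ^ 2 ≠ ν + 0 * r) := by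
      constructor
      intro r hr
      rw [quadraticChar_neg_one_iff_not_isSquare] at hν
      exact hν ⟨r, by rw [← pow_two, hr]; ring⟩
    let i' : F →+* (QuadraticAlgebra K ν 0) := (algebraMap K (QuadraticAlgebra K ν 0)).comp i
    let dbl : (QuadraticAlgebra K ν 0) →+ K :=
      { toFun := fun z => 2 * z.re
        map_zero' := by simp
        map_add' := by intro x y; simp [mul_add] }
    refine ⟨(QuadraticAlgebra K ν 0), inferInstance, inferInstance, i', tr.comp dbl, ?_, ?_, ?_, ?_, ?_⟩
    · rw [Fintype.card_congr (QuadraticAlgebra.equivProd ν 0), Fintype.card_prod, hcard, ← pow_add]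
      congr 1; ring
    · refine hsurj.comp ?_
      intro u
      have h2 : (2 : K) ≠ 0 := Ring.two_ne_zero hK2
      refine ⟨⟨u / 2, 0⟩, ?_⟩
      change 2 * (u / 2) = u
      field_simp
    · intro c z
      have : dbl (i' c * z) = i c * dbl z := by
        change 2 * (algebraMap K (QuadraticAlgebra K ν 0) (i c) * z).re = i c * (2 * z.re)
        simp; ring
      simp only [AddMonoidHom.comp_apply, this, hlin]
    · intro y
      obtain ⟨p, hp⟩ := CharP.exists F
      have hpp : p.Prime := CharP.char_is_prime F p
      have : Fact p.Prime := ⟨hpp⟩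
      obtain ⟨f, _, hf⟩ := FiniteField.card F p
      rw [hq] at hf
      have hpA : CharP (QuadraticAlgebra K ν 0) p := charP_of_injective_ringHom i'.injective p
      have h1 : (y ^ q).re = y.re ^ q := by
        have hy : y = algebraMap K (QuadraticAlgebra K ν 0) y.re + algebraMap K (QuadraticAlgebra K ν 0) y.im * QuadraticAlgebra.omega := by
          ext <;> simp
        have h3 : y ^ q = (algebraMap K (QuadraticAlgebra K ν 0) y.re) ^ q + (algebraMap K (QuadraticAlgebra K ν 0) y.im * QuadraticAlgebra.omega) ^ q := by
          conv_lhs => rw [hy]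
          rw [hf, add_pow_char_pow]
        obtain ⟨m, hm⟩ := hodd
        have h4 : (QuadraticAlgebra.omega : (QuadraticAlgebra K ν 0)) ^ q = algebraMap K (QuadraticAlgebra K ν 0) (ν ^ m) * QuadraticAlgebra.omega := by
          have : (QuadraticAlgebra.omega : (QuadraticAlgebra K ν 0)) ^ 2 = algebraMap K (QuadraticAlgebra K ν 0) ν := by
            rw [pow_two]; ext <;> simp
          rw [hm, pow_succ, pow_mul, this, map_pow]
        rw [h3, mul_pow, h4, ← map_pow, ← map_pow]
        simp [-map_pow]
      have h2 : ∀ u : K, tr (2 * u) = 2 * tr u := by intro u; rw [two_mul, map_add, two_mul]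
      change tr (2 * (y ^ q).re) = tr (2 * y.re)
      rw [h1, h2, h2, hfrob]
    · intro ψ hψ b hb
      have hb' : i b ≠ 0 := by simpa using hb
      let ψ' : AddChar K ℂ := ψ.compAddMonoidHom tr
      have hψ' : ψ' ≠ 1 := by
        rw [AddChar.ne_one_iff] at hψ ⊢
        obtain ⟨x, hx⟩ := hψ
        obtain ⟨y, rfl⟩ := hsurj x
        exact ⟨y, hx⟩
      have h1 := Kl_step hK2 ν hν ψ' hψ' (i b) hb'
      have h2 := hKl ψ hψ b hb
      change Kl (K := QuadraticAlgebra K ν 0) (fun z => ψ' (2 * z.re)) (algebraMap K _ (i b)) = _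
      rw [h1, hcard]
      change _ - Kl (fun z => ψ (tr z)) (i b) ^ 2 = _
      rw [h2]
      simp only [Tk]; push_cast; rfl

open Finset in
lemma artin_sum {F : Type} [Field F] [Fintype F] [DecidableEq F] (q : ℕ) (hq : Fintype.card F = q) (hodd : Odd q)
    {K : Type} [Field K] [Fintype K] (i : F →+* K) (tr : K →+ F)
    (hfrob : ∀ y, tr (y ^ q) = tr y) (m : ℕ) (hcard : Fintype.card K = (q ^ m) ^ 2) (hm : 4 * q < q ^ m)
    (ψ : AddChar F ℂ) (hψ : ψ ≠ 1) (b : F) (hb : b ≠ 0) :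
    -((8 * q + 6 : ℝ) * (q : ℝ) ^ m) ≤ ∑ c ∈ univ.erase (0 : F), (Kl (fun z => ψ (c * tr z)) (i b)).re := by
  classical
  obtain ⟨p, hp⟩ := CharP.exists F
  have hpp : p.Prime := CharP.char_is_prime F p
  have : Fact p.Prime := ⟨hpp⟩
  obtain ⟨f, _, hf⟩ := FiniteField.card F p
  rw [hq] at hf
  have hpK : CharP K p := charP_of_injective_ringHom i.injective p
  have hq2 : 2 ≤ q := by rw [← hq]; exact Fintype.one_lt_card
  have hib : i b ≠ 0 := by simpa using hb
  have hK2 : ringChar K ≠ 2 := ringChar_ne_two_of_odd (by rw [hcard]; exact (hodd.pow).pow)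
  have hqK : (q : K) = 0 := by
    have : (q : F) = 0 := by rw [← hq]; exact FiniteField.cast_card_eq_zero F
    have h := congrArg i this
    simpa using h
  have hS := stepanov_app p (f * m) (q ^ m) q (by rw [hf, ← pow_mul]) hcard hodd.pow hq2 hqK (i b) hib hm
  -- the total sum over all characters
  have hA : ∑ c : F, Kl (fun z => ψ (c * tr z)) (i b) =
      ∑ x ∈ univ.erase (0 : K), ((if tr (x + i b * x⁻¹) = 0 then q else 0 : ℕ) : ℂ) := by
    simp only [Kl_eq]
    rw [Finset.sum_comm]
    refine Finset.sum_congr rfl fun x _ => ?_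
    rw [AddChar.sum_mulShift _ (AddChar.IsPrimitive.of_ne_one hψ), hq]
  have hB : ∀ z : K, (univ.filter fun y : K => y ^ q - y = z).card ≤ (if tr z = 0 then q else 0 : ℕ) := by
    intro z
    split_ifs with hz
    · have hd : (Polynomial.X ^ q - Polynomial.X - Polynomial.C z : Polynomial K).natDegree = q := by
        rw [Polynomial.natDegree_sub_C, FiniteField.X_pow_card_sub_X_natDegree_eq K (by omega)]
      have hne : (Polynomial.X ^ q - Polynomial.X - Polynomial.C z : Polynomial K) ≠ 0 := by
        intro h; rw [h] at hd; simp at hd; omega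
      conv_rhs => rw [← hd]
      apply Polynomial.card_le_degree_of_subset_roots
      intro y hy
      have hy : y ∈ univ.filter fun y : K => y ^ q - y = z := hy
      simp only [mem_filter, mem_univ, true_and] at hy
      rw [Polynomial.mem_roots hne]
      simp [hy]
    · rw [Nat.le_zero, card_eq_zero, filter_eq_empty_iff]
      rintro y _ rfl
      apply hz
      rw [map_sub, hfrob, sub_self]
  have hC : ((∑ x ∈ univ.erase (0 : K), (univ.filter fun y : K => y ^ q - y = x + i b * x⁻¹).card : ℕ) : ℂ) =
      ((Fintype.card K + ∑ y : K, quadraticChar K ((y ^ q - y) ^ 2 - 4 * i b) : ℤ) : ℂ) := by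
    have h1 : ∀ y : K, ∑ x ∈ univ.erase (0 : K), (if y ^ q - y = x + i b * x⁻¹ then (1 : ℂ) else 0) =
        1 + (quadraticChar K ((y ^ q - y) ^ 2 - 4 * i b) : ℂ) := by
      intro y
      have := root_count hK2 (i b) hib (fun z => if y ^ q - y = z then (1 : ℂ) else 0)
      rw [this]
      simp
    push_cast
    rw [← Finset.card_univ, Finset.cast_card, ← Finset.sum_add_distrib, ← Finset.sum_congr rfl fun y _ => h1 y,
      Finset.sum_comm]
    refine Finset.sum_congr rfl fun x _ => ?_
    rw [Finset.sum_boole]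
  have hC' : (∑ x ∈ univ.erase (0 : K), (univ.filter fun y : K => y ^ q - y = x + i b * x⁻¹).card : ℕ) =
      (Fintype.card K + ∑ y : K, quadraticChar K ((y ^ q - y) ^ 2 - 4 * i b) : ℤ) := by exact_mod_cast hC
  have hD : (∑ x ∈ univ.erase (0 : K), (univ.filter fun y : K => y ^ q - y = x + i b * x⁻¹).card : ℕ) ≤
      ∑ x ∈ univ.erase (0 : K), (if tr (x + i b * x⁻¹) = 0 then q else 0 : ℕ) :=
    Finset.sum_le_sum fun x _ => hB _
  have hE : ∑ c : F, (Kl (fun z => ψ (c * tr z)) (i b)).re =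
      ((∑ x ∈ univ.erase (0 : K), (if tr (x + i b * x⁻¹) = 0 then q else 0 : ℕ) : ℕ) : ℝ) := by
    rw [← Complex.re_sum, hA, ← Nat.cast_sum, Complex.natCast_re]
  rw [← Finset.add_sum_erase univ _ (mem_univ (0 : F))] at hE
  have h0 : (Kl (fun z => ψ (0 * tr z)) (i b)).re = Fintype.card K - 1 := by
    simp [Kl]
  rw [h0] at hE
  have hS' : (-((8 * q + 6 : ℝ) * (q : ℝ) ^ m)) ≤ ((∑ y : K, quadraticChar K ((y ^ q - y) ^ 2 - 4 * i b) : ℤ) : ℝ) := by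
    have := (Int.cast_le (R := ℝ)).2 hS
    push_cast at this ⊢
    exact this
  have hD' : ((Fintype.card K : ℝ) + ((∑ y : K, quadraticChar K ((y ^ q - y) ^ 2 - 4 * i b) : ℤ) : ℝ)) ≤
     ((∑ x ∈ univ.erase (0 : K), (if tr (x + i b * x⁻¹) = 0 then q else 0 : ℕ) : ℕ) : ℝ) := by
    have h5 := (Int.cast_inj (α := ℝ)).2 hC'
    rw [Int.cast_add, Int.cast_natCast, Int.cast_natCast] at h5
    rw [← h5]
    exact_mod_cast hD
  linarith

open Finset in
lemma Kl_real {F : Type} [Field F] [Fintype F] (ψ : AddChar F ℂ) (b : F) : ((Kl ψ b).re : ℂ) = Kl ψ b := by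
  rw [← Complex.conj_eq_iff_re]
  simp only [Kl, map_sub, map_sum, AddChar.map_zero_eq_one, map_one]
  congr 1
  rw [← Equiv.sum_comp (Equiv.neg F)]
  refine Finset.sum_congr rfl fun x _ => ?_
  rw [← AddChar.map_neg_eq_conj]
  congr 1
  simp; ring

open Finset in
theorem weil_kloosterman {F : Type} [Field F] [Fintype F] [DecidableEq F] (q : ℕ) (hq : Fintype.card F = q) (hodd : Odd q)
    (ψ : AddChar F ℂ) (hψ : ψ ≠ 1) (b : F) (hb : b ≠ 0) : ‖Kl ψ b‖ ^ 2 ≤ 4 * q := by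
  have hq2 : 2 ≤ q := by rw [← hq]; exact Fintype.one_lt_card
  have hqR : (2 : ℝ) ≤ q := by exact_mod_cast hq2
  set x : F → ℝ := fun c => (Kl (AddChar.mulShift ψ c) b).re with hx
  have hbound : ∀ k : ℕ, 4 * q < q ^ (2 ^ k) →
      -((8 * q + 6 : ℝ) * (q : ℝ) ^ (2 ^ k)) ≤ ∑ c ∈ univ.erase (0 : F), Tk q (k + 1) (x c) := by
    intro k hk
    obtain ⟨K, _, _, i, tr, hcard, hsurj, hlin, hfrob, hKl⟩ := tower (F := F) q hq hodd (k + 1)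
    have h1 := artin_sum q hq hodd i tr hfrob (2 ^ k) (by rw [hcard]; ring) hk ψ hψ b hb
    refine h1.trans (le_of_eq (Finset.sum_congr rfl fun c hc => ?_))
    have hc : c ≠ 0 := by simpa using hc
    have h2 := hKl (AddChar.mulShift ψ c) (AddChar.IsPrimitive.of_ne_one hψ hc) b hb
    rw [← Kl_real, ← Tk_cast] at h2
    simp only [AddChar.mulShift_apply] at h2
    rw [h2, Complex.ofReal_re]
  have hup : ∀ k c, Tk q (k + 1) (x c) ≤ 2 * (q : ℝ) ^ (2 ^ k) := by
    intro k c
    simp only [Tk]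
    nlinarith [sq_nonneg (Tk q k (x c))]
  have hx1 : ‖Kl ψ b‖ ^ 2 = x 1 ^ 2 := by
    simp only [hx, AddChar.mulShift_one]
    conv_lhs => rw [← Kl_real, Complex.norm_real, Real.norm_eq_abs, sq_abs]
  rw [hx1]
  by_contra hlt
  push Not at hlt
  set δ := (x 1 ^ 2 - 4 * q) / q with hδ
  have hδ0 : 0 < δ := div_pos (by linarith) (by linarith)
  have hgrow : ∀ k : ℕ, (2 + (k + 1) * δ) * (q : ℝ) ^ (2 ^ k) ≤ - Tk q (k + 1) (x 1) := by
    intro k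
    induction k with
    | zero =>
      have : δ * q = x 1 ^ 2 - 4 * q := by rw [hδ]; field_simp
      simp only [Tk]; norm_num; linarith
    | succ k ih =>
      rw [Tk]
      have hQ : (0 : ℝ) < (q : ℝ) ^ (2 ^ k) := by positivity
      have e : (q : ℝ) ^ (2 ^ (k + 1)) = ((q : ℝ) ^ (2 ^ k)) ^ 2 := by ring
      rw [e]
      set Q := (q : ℝ) ^ (2 ^ k)
      set t := Tk q (k + 1) (x 1)
      have hk0 : (0 : ℝ) ≤ k * δ := by positivity
      have h3 : ((2 + (k + 1) * δ) * Q) ^ 2 ≤ t ^ 2 := by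
        rw [← neg_sq t]
        exact pow_le_pow_left₀ (by positivity) ih 2
      push_cast
      have h4 : (2 + (k + 1 + 1) * δ) * Q ^ 2 ≤ ((2 + (k + 1) * δ) * Q) ^ 2 - 2 * Q ^ 2 := by
        have h5 : (2 + (k + 1 + 1) * δ) ≤ (2 + (k + 1) * δ) ^ 2 - 2 := by
          nlinarith [sq_nonneg ((k + 1) * δ)]
        calc _ ≤ ((2 + (k + 1) * δ) ^ 2 - 2) * Q ^ 2 := by gcongr
          _ = _ := by ring
      linarith
  have hq3 : 3 ≤ q := by
    rcases Nat.lt_or_ge q 3 with h | h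
    · have : q = 2 := by omega
      rw [this] at hodd; exact absurd hodd (by decide)
    · exact h
  obtain ⟨n, hn⟩ := exists_nat_gt ((10 * q + 6 : ℝ) / δ)
  set k := n + 2 with hk
  have hbig : 4 * q < q ^ (2 ^ k) := by
    have h4 : 4 ≤ 2 ^ k := by
      calc 4 = 2 ^ 2 := rfl
        _ ≤ 2 ^ k := Nat.pow_le_pow_right (by norm_num) (by omega)
    calc 4 * q < q ^ 4 := by nlinarith [mul_le_mul hq3 hq3 (by norm_num) (by omega), mul_le_mul (mul_le_mul hq3 hq3 (by norm_num) (by omega)) hq3 (by norm_num) (by positivity)]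
      _ ≤ q ^ (2 ^ k) := Nat.pow_le_pow_right (by omega) h4
  have h1 := hbound k hbig
  have hm1 : (1 : F) ∈ univ.erase (0 : F) := by simp
  rw [← Finset.add_sum_erase _ _ hm1] at h1
  have hQ : (0 : ℝ) < (q : ℝ) ^ (2 ^ k) := by positivity
  have h2 : ∑ c ∈ (univ.erase (0 : F)).erase 1, Tk q (k + 1) (x c) ≤ q * (2 * (q : ℝ) ^ (2 ^ k)) := by
    calc _ ≤ ∑ c ∈ (univ.erase (0 : F)).erase 1, (2 * (q : ℝ) ^ (2 ^ k)) := Finset.sum_le_sum fun c _ => hup k c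
      _ ≤ ∑ c : F, (2 * (q : ℝ) ^ (2 ^ k)) :=
        Finset.sum_le_sum_of_subset_of_nonneg (Finset.subset_univ _) fun _ _ _ => by positivity
      _ = _ := by rw [Finset.sum_const, Finset.card_univ, hq, nsmul_eq_mul]
  have h3 := hgrow k
  have h4 : (2 + (k + 1) * δ) * (q : ℝ) ^ (2 ^ k) ≤ (10 * q + 6) * (q : ℝ) ^ (2 ^ k) := by linarith
  have h5 := le_of_mul_le_mul_right h4 hQ
  rw [div_lt_iff₀ hδ0] at hn
  have hkn : (k : ℝ) = n + 2 := by rw [hk]; push_cast; ring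
  rw [hkn] at h5
  nlinarith

open Finset

/-- The quadratic Gauss sum. -/
noncomputable def GS {F : Type} [Field F] [Fintype F] [DecidableEq F] (ψ : AddChar F ℂ) : ℂ :=
  ∑ t : F, (quadraticChar F t : ℂ) * ψ t

section
variable {F : Type} [Field F] [Fintype F] [DecidableEq F]

lemma GS_norm (hF : ringChar F ≠ 2) (ψ : AddChar F ℂ) (hψ : ψ ≠ 1) : ‖GS ψ‖ ^ 2 = Fintype.card F := by
  let χ : MulChar F ℂ := (quadraticChar F).ringHomComp (Int.castRingHom ℂ)
  have hχ : χ ≠ 1 := by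
    intro h
    obtain ⟨a, ha⟩ := quadraticChar_exists_neg_one' hF
    have := congrArg (fun f : MulChar F ℂ => f a) h
    simp only [MulChar.one_apply a.isUnit] at this
    change ((quadraticChar F a : ℤ) : ℂ) = 1 at this
    rw [ha] at this
    norm_num at this
  have hG : GS ψ = gaussSum χ ψ := rfl
  have h1 := gaussSum_mul_gaussSum_eq_card hχ (AddChar.IsPrimitive.of_ne_one hψ)
  have h2 := star_gaussSum_eq χ ψ
  rw [← h2, ← hG] at h1
  have h3 : (GS ψ) * star (GS ψ) = ((‖GS ψ‖ ^ 2 : ℝ) : ℂ) := by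
    rw [Complex.star_def, Complex.mul_conj, Complex.normSq_eq_norm_sq]
  rw [h3] at h1
  exact_mod_cast h1

lemma GS_mul (ψ : AddChar F ℂ) (s : F) (hs : s ≠ 0) :
    ∑ t : F, (quadraticChar F t : ℂ) * ψ (s * t) = (quadraticChar F s : ℂ) * GS ψ := by
  rw [GS, ← Equiv.sum_comp (Equiv.mulLeft₀ s hs) (fun t => (quadraticChar F t : ℂ) * ψ t), mul_sum]
  refine sum_congr rfl fun t _ => ?_
  have h : (quadraticChar F s : ℂ) * (quadraticChar F s : ℂ) = 1 := by
    have := quadraticChar_sq_one hs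
    rw [pow_two] at this
    exact_mod_cast this
  change _ = (quadraticChar F s : ℂ) * ((quadraticChar F (s * t) : ℂ) * ψ (s * t))
  rw [map_mul (quadraticChar F)]
  push_cast
  linear_combination (-((quadraticChar F t : ℂ) * ψ (s * t))) * h

lemma sum_sq_fiber (hF : ringChar F ≠ 2) (g : F → ℂ) :
    ∑ z : F, g (z ^ 2) = ∑ t : F, (1 + (quadraticChar F t : ℂ)) * g t := by
  have h : ∀ t : F, (1 + (quadraticChar F t : ℂ)) * g t = ∑ z : F, if z ^ 2 = t then g t else 0 := by
    intro t
    have h1 := quadraticChar_card_sqrts hF t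
    rw [← sum_filter, sum_const, nsmul_eq_mul]
    congr 1
    have h2 : ((univ.filter fun z : F => z ^ 2 = t).card : ℤ) = quadraticChar F t + 1 := by
      rw [← h1]
      congr 2
      ext z; simp
    have h3 := (Int.cast_inj (α := ℂ)).2 h2
    push_cast at h3
    rw [h3, add_comm]
  simp_rw [h]
  rw [sum_comm]
  simp

lemma gauss_quad (hF : ringChar F ≠ 2) (ψ : AddChar F ℂ) (hψ : ψ ≠ 1) (s : F) (hs : s ≠ 0) (m : F) :
    ∑ z : F, ψ (s * z ^ 2 + m * z) = (quadraticChar F s : ℂ) * GS ψ * ψ (-(m ^ 2 / 4 * s⁻¹)) := by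
  have h2 : (2 : F) ≠ 0 := Ring.two_ne_zero hF
  have h4 : (4 : F) ≠ 0 := by have : (4 : F) = 2 * 2 := by norm_num
                              rw [this]; exact mul_ne_zero h2 h2
  rw [← Equiv.sum_comp (Equiv.subRight (m / (2 * s)))]
  have h1 : ∀ z : F, ψ (s * (Equiv.subRight (m / (2 * s)) z) ^ 2 + m * (Equiv.subRight (m / (2 * s)) z)) =
      ψ (s * z ^ 2) * ψ (-(m ^ 2 / 4 * s⁻¹)) := by
    intro z
    rw [← AddChar.map_add_eq_mul]
    congr 1
    simp only [Equiv.subRight_apply]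
    field_simp
    ring
  simp_rw [h1]
  rw [← sum_mul, sum_sq_fiber hF (fun t => ψ (s * t))]
  congr 1
  simp_rw [add_mul, one_mul]
  rw [sum_add_distrib, GS_mul ψ s hs]
  have : ∑ t : F, ψ (s * t) = 0 := by
    have := AddChar.sum_mulShift s (AddChar.IsPrimitive.of_ne_one hψ)
    simp_rw [mul_comm _ s] at this
    rw [this, if_neg hs]; simp
  rw [this, zero_add]

lemma salie_nonsq (ψ : AddChar F ℂ) (b : F) (hb : quadraticChar F b = -1) :
    ∑ s : F, (quadraticChar F s : ℂ) * ψ (s + b * s⁻¹) = 0 := by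
  have hb0 : b ≠ 0 := by rintro rfl; simp at hb
  have hinv : Function.Involutive (fun s : F => b * s⁻¹) := by
    intro s
    by_cases hs : s = 0
    · simp [hs]
    · field_simp
  have h := Equiv.sum_comp hinv.toPerm (fun s : F => (quadraticChar F s : ℂ) * ψ (s + b * s⁻¹))
  have h1 : ∀ s : F, (quadraticChar F (b * s⁻¹) : ℂ) * ψ (b * s⁻¹ + b * (b * s⁻¹)⁻¹) =
      - ((quadraticChar F s : ℂ) * ψ (s + b * s⁻¹)) := by
    intro s
    have e : b * (b * s⁻¹)⁻¹ = s := hinv s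
    rw [e, map_mul, hb, add_comm (b * s⁻¹)]
    have : quadraticChar F s⁻¹ = quadraticChar F s := by
      by_cases hs : s = 0
      · simp [hs]
      · have h3 : quadraticChar F s⁻¹ * quadraticChar F s = 1 := by
          rw [← map_mul, inv_mul_cancel₀ hs, map_one]
        have h4 := quadraticChar_sq_one hs
        calc quadraticChar F s⁻¹ = quadraticChar F s⁻¹ * (quadraticChar F s ^ 2) := by rw [h4, mul_one]
          _ = (quadraticChar F s⁻¹ * quadraticChar F s) * quadraticChar F s := by ring
          _ = _ := by rw [h3, one_mul]
    rw [this]; push_cast; ring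
  change ∑ s : F, (quadraticChar F (b * s⁻¹) : ℂ) * ψ (b * s⁻¹ + b * (b * s⁻¹)⁻¹) = _ at h
  simp_rw [h1] at h
  rw [sum_neg_distrib] at h
  have h5 : (2 : ℂ) * ∑ s : F, (quadraticChar F s : ℂ) * ψ (s + b * s⁻¹) = 0 := by
    linear_combination -h
  simpa using h5

lemma salie_sq (hF : ringChar F ≠ 2) (ψ : AddChar F ℂ) (c : F) (hc : c ≠ 0) :
    ∑ s : F, (quadraticChar F s : ℂ) * ψ (s + c ^ 2 * s⁻¹) = GS ψ * (ψ (2 * c) + ψ (-(2 * c))) := by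
  have h2 : (2 : F) ≠ 0 := Ring.two_ne_zero hF
  have h4 : (4 : F) ≠ 0 := by have : (4 : F) = 2 * 2 := by norm_num
                              rw [this]; exact mul_ne_zero h2 h2
  have hsq : ∀ x : F, x ≠ 0 → (quadraticChar F x : ℂ) ^ 2 = 1 := fun x hx => by
    exact_mod_cast quadraticChar_sq_one hx
  have hsq' : ∀ x : F, x ≠ 0 → quadraticChar F (x ^ 2) = 1 := fun x hx => quadraticChar_sq_one' hx
  have hcc : c ≠ -c := by
    intro h
    have : 2 * c = 0 := by linear_combination h
    exact mul_ne_zero h2 hc this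
  have h4c : ∀ x : F, quadraticChar F (4 * x) = quadraticChar F x := by
    intro x
    have : (4 : F) * x = 2 ^ 2 * x := by ring
    rw [this, map_mul, hsq' 2 h2, one_mul]
  set η : F → ℂ := fun x => (quadraticChar F x : ℂ) with hη
  set g : F → ℂ := fun z => ψ z * (η (z + 2 * c) + η (z - 2 * c)) with hg
  have key := root_count hF (c ^ 2) (pow_ne_zero 2 hc) g
  -- left side
  have hL : ∀ s ∈ univ.erase (0 : F), g (s + c ^ 2 * s⁻¹) = 2 * (η s * ψ (s + c ^ 2 * s⁻¹)) -
      (if s = -c then η (-c) * ψ (-(2 * c)) else 0) - (if s = c then η c * ψ (2 * c) else 0) := by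
    intro s hs
    have hs : s ≠ 0 := by simpa using hs
    have e1 : s + c ^ 2 * s⁻¹ + 2 * c = s * ((s + c) * s⁻¹) ^ 2 := by field_simp; ring
    have e2 : s + c ^ 2 * s⁻¹ - 2 * c = s * ((s - c) * s⁻¹) ^ 2 := by field_simp; ring
    have f1 : s ≠ -c → η (s + c ^ 2 * s⁻¹ + 2 * c) = η s := by
      intro h
      have : s + c ≠ 0 := fun h' => h (by linear_combination h')
      simp only [hη, e1, map_mul (quadraticChar F) s]
      rw [hsq' _ (mul_ne_zero this (inv_ne_zero hs)), mul_one]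
    have f2 : s ≠ c → η (s + c ^ 2 * s⁻¹ - 2 * c) = η s := by
      intro h
      have : s - c ≠ 0 := fun h' => h (by linear_combination h')
      simp only [hη, e2, map_mul (quadraticChar F) s]
      rw [hsq' _ (mul_ne_zero this (inv_ne_zero hs)), mul_one]
    by_cases h1 : s = -c
    · have h3 : s ≠ c := by rw [h1]; exact hcc.symm
      have f3 : η (s + c ^ 2 * s⁻¹ + 2 * c) = 0 := by
        rw [e1, h1]; simp [hη]
      simp only [hg]
      rw [f3, f2 h3, if_pos h1, if_neg h3]
      have : s + c ^ 2 * s⁻¹ = -(2 * c) := by rw [h1]; field_simp; ring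
      rw [this, h1]; ring
    · by_cases h3 : s = c
      · have f3 : η (s + c ^ 2 * s⁻¹ - 2 * c) = 0 := by
          rw [e2, h3]; simp [hη]
        simp only [hg]
        rw [f3, f1 h1, if_neg h1, if_pos h3]
        have : s + c ^ 2 * s⁻¹ = (2 * c) := by rw [h3]; field_simp; ring
        rw [this, h3]; ring
      · simp only [hg]
        rw [f1 h1, f2 h3, if_neg h1, if_neg h3]; ring
  have hR : ∀ z : F, g z * (1 + (quadraticChar F (z ^ 2 - 4 * c ^ 2) : ℂ)) = 2 * g z -
      (if z = -(2 * c) then η (-c) * ψ (-(2 * c)) else 0) - (if z = 2 * c then η c * ψ (2 * c) else 0) := by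
    intro z
    have e : z ^ 2 - 4 * c ^ 2 = (z + 2 * c) * (z - 2 * c) := by ring
    have e' : (quadraticChar F (z ^ 2 - 4 * c ^ 2) : ℂ) = η (z + 2 * c) * η (z - 2 * c) := by
      rw [e, map_mul]; push_cast; rfl
    rw [e']
    have hcc2 : 2 * c ≠ -(2 * c) := by
      intro h
      have : 4 * c = 0 := by linear_combination h
      exact mul_ne_zero h4 hc this
    have η0 : η 0 = 0 := by simp [hη]
    by_cases h1 : z = -(2 * c)
    · have h3 : z ≠ 2 * c := by rw [h1]; exact hcc2.symm
      rw [if_pos h1, if_neg h3]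
      have a1 : z + 2 * c = 0 := by rw [h1]; ring
      have a2 : η (z - 2 * c) = η (-c) := by
        have : z - 2 * c = 4 * (-c) := by rw [h1]; ring
        simp only [hη, this, h4c]
      simp only [hg, a1, a2, η0]; rw [h1]; ring
    · by_cases h3 : z = 2 * c
      · rw [if_neg h1, if_pos h3]
        have a1 : z - 2 * c = 0 := by rw [h3]; ring
        have a2 : η (z + 2 * c) = η c := by
          have : z + 2 * c = 4 * c := by rw [h3]; ring
          simp only [hη, this, h4c]
        simp only [hg, a1, a2, η0]; rw [h3]; ring
      · rw [if_neg h1, if_neg h3]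
        have a1 := hsq (z + 2 * c) (fun h' => h1 (by linear_combination h'))
        have a2 := hsq (z - 2 * c) (fun h' => h3 (by linear_combination h'))
        change η _ ^ 2 = 1 at a1
        change η _ ^ 2 = 1 at a2
        simp only [hg]
        linear_combination (ψ z * η (z - 2 * c)) * a1 + (ψ z * η (z + 2 * c)) * a2
  rw [sum_congr rfl hL, sum_congr rfl fun z _ => hR z] at key
  simp only [sum_sub_distrib, ← mul_sum, sum_ite_eq', mem_univ, if_true, mem_erase, and_true] at key
  rw [if_pos (neg_ne_zero.2 hc), if_pos hc] at key
  have k2 : ∑ s ∈ univ.erase (0 : F), η s * ψ (s + c ^ 2 * s⁻¹) = ∑ z, g z := by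
    linear_combination key / 2
  rw [← add_sum_erase univ _ (mem_univ (0 : F)), k2]
  have η0 : η 0 = 0 := by simp [hη]
  change η 0 * _ + _ = _
  rw [η0, zero_mul, zero_add]
  simp only [hg, mul_add, sum_add_distrib]
  have s1 : ∑ z, ψ z * η (z + 2 * c) = GS ψ * ψ (-(2 * c)) := by
    rw [GS, sum_mul, ← Equiv.sum_comp (Equiv.subRight (2 * c))]
    refine sum_congr rfl fun z _ => ?_
    simp only [Equiv.subRight_apply, sub_add_cancel]
    rw [sub_eq_add_neg, AddChar.map_add_eq_mul]; ring
  have s2 : ∑ z, ψ z * η (z - 2 * c) = GS ψ * ψ (2 * c) := by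
    rw [GS, sum_mul, ← Equiv.sum_comp (Equiv.addRight (2 * c))]
    refine sum_congr rfl fun z _ => ?_
    simp only [Equiv.coe_addRight, add_sub_cancel_right]
    rw [AddChar.map_add_eq_mul]; ring
  rw [s1, s2]; ring

lemma SS_bound (q : ℕ) (hq : Fintype.card F = q) (hodd : Odd q) (ψ : AddChar F ℂ) (hψ : ψ ≠ 1) (d : ℕ) (b : F) :
    ‖∑ s ∈ univ.erase (0 : F), (quadraticChar F s : ℂ) ^ d * ψ (s + b * s⁻¹)‖ ^ 2 ≤ 4 * q := by
  have hF : ringChar F ≠ 2 := ringChar_ne_two_of_odd (by rw [hq]; exact hodd)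
  have hq1 : (1 : ℝ) ≤ q := by exact_mod_cast hodd.pos
  have hG := GS_norm hF ψ hψ
  rw [hq] at hG
  have hsq : ∀ x : F, x ≠ 0 → (quadraticChar F x : ℂ) ^ 2 = 1 := fun x hx => by
    exact_mod_cast quadraticChar_sq_one hx
  rcases Nat.even_or_odd' d with ⟨k, rfl | rfl⟩
  · have h1 : ∑ s ∈ univ.erase (0 : F), (quadraticChar F s : ℂ) ^ (2 * k) * ψ (s + b * s⁻¹) = Kl ψ b := by
      rw [Kl_eq]
      refine sum_congr rfl fun s hs => ?_
      rw [pow_mul, hsq s (by simpa using hs), one_pow, one_mul]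
    rw [h1]
    by_cases hb : b = 0
    · have : Kl ψ b = -1 := by
        simp [Kl, hb, AddChar.sum_eq_zero_of_ne_one hψ]
      rw [this]; norm_num; linarith
    · exact weil_kloosterman q hq hodd ψ hψ b hb
  · have h1 : ∑ s ∈ univ.erase (0 : F), (quadraticChar F s : ℂ) ^ (2 * k + 1) * ψ (s + b * s⁻¹) =
        ∑ s : F, (quadraticChar F s : ℂ) * ψ (s + b * s⁻¹) := by
      rw [← add_sum_erase univ _ (mem_univ (0 : F))]
      simp only [MulChar.map_zero, Int.cast_zero, zero_mul, zero_add]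
      refine sum_congr rfl fun s hs => ?_
      rw [pow_succ, pow_mul, hsq s (by simpa using hs), one_pow, one_mul]
    rw [h1]
    by_cases hb : b = 0
    · have : ∑ s : F, (quadraticChar F s : ℂ) * ψ (s + b * s⁻¹) = GS ψ := by simp [hb, GS]
      rw [this, hG]; linarith
    · by_cases hs : IsSquare b
      · obtain ⟨c, hc⟩ := hs
        have hc0 : c ≠ 0 := by rintro rfl; simp at hc; exact hb hc
        rw [← pow_two] at hc
        rw [hc, salie_sq hF ψ c hc0, norm_mul, mul_pow, hG]
        have h3 : ‖ψ (2 * c) + ψ (-(2 * c))‖ ≤ 2 := by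
          refine (norm_add_le _ _).trans ?_
          rw [AddChar.norm_apply, AddChar.norm_apply]; norm_num
        have h4 : ‖ψ (2 * c) + ψ (-(2 * c))‖ ^ 2 ≤ 4 := by
          nlinarith [norm_nonneg (ψ (2 * c) + ψ (-(2 * c)))]
        rw [mul_comm]
        exact mul_le_mul_of_nonneg_right h4 (by linarith)
      · rw [salie_nonsq ψ b (quadraticChar_neg_one_iff_not_isSquare.2 hs)]
        norm_num
end

open Finset

section
variable {F : Type} [Field F] [Fintype F] [DecidableEq F]

lemma char_sum_prod {d : ℕ} (ψ : AddChar F ℂ) (u : Fin d → F) : ψ (∑ j, u j) = ∏ j, ψ (u j) := by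
  classical
  have h : ∀ s : Finset (Fin d), ψ (∑ j ∈ s, u j) = ∏ j ∈ s, ψ (u j) := by
    intro s
    induction s using Finset.induction_on with
    | empty => simp
    | insert a s ha ih => rw [sum_insert ha, prod_insert ha, AddChar.map_add_eq_mul, ih]
  exact h univ

lemma sum_pi_prod {d : ℕ} (g : Fin d → F → ℂ) : ∑ z : Fin d → F, ∏ j, g j (z j) = ∏ j, ∑ t : F, g j t := by
  rw [Finset.prod_univ_sum, Fintype.piFinset_univ]

lemma orth {d : ℕ} (ψ : AddChar F ℂ) (hψ : ψ ≠ 1) (x : Fin d → F) :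
    ∑ m : Fin d → F, ψ (∑ j, m j * x j) = if x = 0 then (Fintype.card F : ℂ) ^ d else 0 := by
  simp_rw [char_sum_prod]
  rw [sum_pi_prod (fun j t => ψ (t * x j))]
  simp_rw [AddChar.sum_mulShift _ (AddChar.IsPrimitive.of_ne_one hψ)]
  split_ifs with h
  · simp [h]
  · obtain ⟨j, hj⟩ := Function.ne_iff.1 h
    exact prod_eq_zero (mem_univ j) (by simp at hj; simp [hj])

/-- Fourier transform on `F^d`. -/
noncomputable def FT {d : ℕ} (ψ : AddChar F ℂ) (f : (Fin d → F) → ℂ) (m : Fin d → F) : ℂ :=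
  ∑ x, f x * ψ (∑ j, m j * x j)

lemma parseval {d : ℕ} (ψ : AddChar F ℂ) (hψ : ψ ≠ 1) (f : (Fin d → F) → ℂ) :
    ∑ m, ‖FT ψ f m‖ ^ 2 = (Fintype.card F : ℝ) ^ d * ∑ x, ‖f x‖ ^ 2 := by
  have h0 : ∀ z : ℂ, ((‖z‖ ^ 2 : ℝ) : ℂ) = z * (starRingEnd ℂ) z := by
    intro z; rw [Complex.mul_conj, Complex.normSq_eq_norm_sq]
  have h : ((∑ m, ‖FT ψ f m‖ ^ 2 : ℝ) : ℂ) = (((Fintype.card F : ℝ) ^ d * ∑ x, ‖f x‖ ^ 2 : ℝ) : ℂ) := by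
    rw [Complex.ofReal_sum, Complex.ofReal_mul, Complex.ofReal_sum]
    simp_rw [h0]
    have h1 : ∀ m : Fin d → F, FT ψ f m * (starRingEnd ℂ) (FT ψ f m) =
        ∑ x, ∑ y, f x * (starRingEnd ℂ) (f y) * ψ (∑ j, m j * (x - y) j) := by
      intro m
      rw [FT, map_sum, sum_mul_sum]
      refine sum_congr rfl fun x _ => sum_congr rfl fun y _ => ?_
      have e : ∑ j, m j * (x - y) j = ∑ j, m j * x j + -(∑ j, m j * y j) := by
        rw [← sub_eq_add_neg, ← sum_sub_distrib]
        exact sum_congr rfl fun j _ => by simp [mul_sub]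
      rw [e, AddChar.map_add_eq_mul, AddChar.map_neg_eq_conj, map_mul]
      ring
    simp_rw [h1]
    rw [sum_comm, mul_sum]
    refine sum_congr rfl fun x _ => ?_
    rw [sum_comm]
    simp_rw [← mul_sum, orth ψ hψ]
    simp only [sub_eq_zero, mul_ite, mul_zero, sum_ite_eq, mem_univ, if_true]
    push_cast
    ring
  exact_mod_cast h

lemma FT_conv {d : ℕ} (ψ : AddChar F ℂ) (B f : (Fin d → F) → ℂ) (m : Fin d → F) :
    FT ψ (fun x => ∑ y, B (x - y) * f y) m = FT ψ B m * FT ψ f m := by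
  simp only [FT]
  rw [mul_sum]
  simp_rw [sum_mul]
  rw [sum_comm]
  refine sum_congr rfl fun y _ => ?_
  rw [← Equiv.sum_comp (Equiv.addRight y)]
  refine sum_congr rfl fun x _ => ?_
  simp only [Equiv.coe_addRight, add_sub_cancel_right]
  have e : ∑ j, m j * (x + y) j = ∑ j, m j * x j + ∑ j, m j * y j := by
    rw [← sum_add_distrib]
    exact sum_congr rfl fun j _ => by simp [mul_add]
  rw [e, AddChar.map_add_eq_mul]
  ring

lemma conv_bound {d : ℕ} (ψ : AddChar F ℂ) (hψ : ψ ≠ 1) (B f : (Fin d → F) → ℂ) (L : ℝ)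
    (hB : ∀ m, ‖FT ψ B m‖ ^ 2 ≤ L) : ∑ x, ‖∑ y, B (x - y) * f y‖ ^ 2 ≤ L * ∑ x, ‖f x‖ ^ 2 := by
  have hq : (0 : ℝ) < (Fintype.card F : ℝ) ^ d := by
    have : 0 < Fintype.card F := Fintype.card_pos
    positivity
  refine le_of_mul_le_mul_left ?_ hq
  rw [← parseval ψ hψ (fun x => ∑ y, B (x - y) * f y), mul_left_comm, ← parseval ψ hψ f, mul_sum]
  refine sum_le_sum fun m _ => ?_
  rw [FT_conv, norm_mul, mul_pow]
  exact mul_le_mul_of_nonneg_right (hB m) (by positivity)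

/-- `q` times the balanced kernel of the unit sphere. -/
noncomputable def Bk {d : ℕ} (ψ : AddChar F ℂ) (z : Fin d → F) : ℂ :=
  ∑ s ∈ univ.erase (0 : F), ψ (s * (∑ j, z j ^ 2 - 1))

lemma Bk_eq {d : ℕ} (ψ : AddChar F ℂ) (hψ : ψ ≠ 1) (z : Fin d → F) :
    Bk ψ z = (if ∑ j, z j ^ 2 = 1 then (Fintype.card F : ℂ) else 0) - 1 := by
  have h := AddChar.sum_mulShift (∑ j, z j ^ 2 - 1) (AddChar.IsPrimitive.of_ne_one hψ)
  rw [← add_sum_erase univ _ (mem_univ (0 : F))] at h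
  rw [Bk]
  simp only [zero_mul, AddChar.map_zero_eq_one, sub_eq_zero] at h
  split_ifs at h ⊢ with h1
  · rw [← h]; ring
  · push_cast at h; linear_combination h

lemma Bk_FT {d : ℕ} (q : ℕ) (hq : Fintype.card F = q) (hodd : Odd q) (ψ : AddChar F ℂ) (hψ : ψ ≠ 1)
    (m : Fin d → F) : ‖FT ψ (Bk ψ) m‖ ^ 2 ≤ 4 * (q : ℝ) ^ (d + 1) := by
  have hF : ringChar F ≠ 2 := ringChar_ne_two_of_odd (by rw [hq]; exact hodd)
  have hψ' : ψ⁻¹ ≠ 1 := by simpa using hψ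
  set b : F := (∑ j, m j ^ 2) / 4 with hb
  have h1 : FT ψ (Bk ψ) m = GS ψ ^ d *
      ∑ s ∈ univ.erase (0 : F), (quadraticChar F s : ℂ) ^ d * ψ⁻¹ (s + b * s⁻¹) := by
    simp only [FT, Bk]
    simp_rw [sum_mul]
    rw [sum_comm, mul_sum]
    refine sum_congr rfl fun s hs => ?_
    have hs : s ≠ 0 := by simpa using hs
    have h2 : ∀ z : Fin d → F, ψ (s * (∑ j, z j ^ 2 - 1)) * ψ (∑ j, m j * z j) =
        ψ (-s) * ∏ j, ψ (s * z j ^ 2 + m j * z j) := by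
      intro z
      rw [← char_sum_prod, ← AddChar.map_add_eq_mul, ← AddChar.map_add_eq_mul]
      congr 1
      rw [sum_add_distrib, ← mul_sum]; ring
    simp_rw [h2]
    rw [← mul_sum, sum_pi_prod (fun j t => ψ (s * t ^ 2 + m j * t))]
    simp_rw [gauss_quad hF ψ hψ s hs]
    rw [prod_mul_distrib, ← char_sum_prod, prod_const, card_univ, Fintype.card_fin, AddChar.inv_apply]
    have h3 : ψ (-(s + b * s⁻¹)) = ψ (-s) * ψ (∑ j, -(m j ^ 2 / 4 * s⁻¹)) := by
      rw [← AddChar.map_add_eq_mul]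
      congr 1
      rw [sum_neg_distrib, ← sum_mul, ← sum_div]; ring
    rw [h3]; ring
  have h4 := SS_bound q hq hodd ψ⁻¹ hψ' d b
  have hG := GS_norm hF ψ hψ
  rw [hq] at hG
  rw [h1, norm_mul, mul_pow, norm_pow, ← pow_mul, mul_comm d 2, pow_mul, hG]
  calc _ ≤ (q : ℝ) ^ d * (4 * q) := by gcongr
    _ = _ := by ring
end

theorem statement15 {F : Type} [Field F] [Fintype F] [DecidableEq F] (q : ℕ)
    (hq : Fintype.card F = q) (hodd : Odd q) (d : ℕ) (hd : 2 ≤ d)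
    (E : Finset (Fin d → F))
    (hE : (4 / Real.log 2) * (q : ℝ) ^ (((d : ℝ) + 1) / 2) ≤ (E.card : ℝ)) :
    (((E ×ˢ E ×ˢ E).filter
        (fun p : (Fin d → F) × (Fin d → F) × (Fin d → F) =>
          (∑ j, (p.1 j - p.2.1 j) ^ 2 = 1) ∧ (∑ j, (p.1 j - p.2.2 j) ^ 2 = 1))).card : ℝ)
      ≤ ((E.card : ℝ) ^ 3 + 6 * (q : ℝ) ^ (((d : ℝ) + 1) / 2) * (E.card : ℝ) ^ 2) / (q : ℝ) ^ 2 := by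
  have hq0 : (0 : ℝ) < q := by exact_mod_cast hodd.pos
  obtain ⟨ψ, hψ⟩ : ∃ ψ : AddChar F ℂ, ψ ≠ 1 := by
    obtain ⟨ψ, hψ⟩ := AddChar.exists_apply_ne_zero.2 (one_ne_zero (α := F))
    exact ⟨ψ, (AddChar.ne_one_iff).2 ⟨1, hψ⟩⟩
  set R : ℝ := (q : ℝ) ^ (((d : ℝ) + 1) / 2) with hR
  have hR0 : 0 < R := Real.rpow_pos_of_pos hq0 _
  have hR2 : R ^ 2 = (q : ℝ) ^ (d + 1) := by
    rw [hR, ← Real.rpow_natCast, ← Real.rpow_mul hq0.le, ← Real.rpow_natCast]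
    congr 1
    push_cast; ring
  set N : ℝ := (E.card : ℝ) with hN
  have hNR : 2 * R ≤ N := by
    refine le_trans ?_ hE
    gcongr
    have h1 : 0 < Real.log 2 := Real.log_pos (by norm_num)
    rw [le_div_iff₀ h1]
    linarith [Real.log_two_lt_d9]
  set deg : (Fin d → F) → ℕ := fun x => (E.filter fun y => ∑ j, (x j - y j) ^ 2 = 1).card with hdeg
  have hcard : (((E ×ˢ E ×ˢ E).filter
        (fun p : (Fin d → F) × (Fin d → F) × (Fin d → F) =>
          (∑ j, (p.1 j - p.2.1 j) ^ 2 = 1) ∧ (∑ j, (p.1 j - p.2.2 j) ^ 2 = 1))).card : ℝ) =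
      ∑ x ∈ E, (deg x : ℝ) ^ 2 := by
    have : ((E ×ˢ E ×ˢ E).filter
        (fun p : (Fin d → F) × (Fin d → F) × (Fin d → F) =>
          (∑ j, (p.1 j - p.2.1 j) ^ 2 = 1) ∧ (∑ j, (p.1 j - p.2.2 j) ^ 2 = 1))).card =
        ∑ x ∈ E, (deg x) ^ 2 := by
      rw [card_filter, sum_product]
      refine sum_congr rfl fun x _ => ?_
      rw [← card_filter]
      rw [filter_product (fun y : Fin d → F => ∑ j, (x j - y j) ^ 2 = 1) (fun y : Fin d → F => ∑ j, (x j - y j) ^ 2 = 1), card_product, pow_two]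
    rw [this]; push_cast; rfl
  rw [hcard]
  set a : (Fin d → F) → ℝ := fun x => q * deg x - N with ha
  have hconv : ∀ x, ∑ y, Bk ψ (x - y) * (if y ∈ E then (1 : ℂ) else 0) = (a x : ℂ) := by
    intro x
    simp only [mul_ite, mul_one, mul_zero, sum_ite_mem, univ_inter, Bk_eq ψ hψ, sum_sub_distrib,
      ← sum_filter, Pi.sub_apply, sum_const, nsmul_eq_mul, hq]
    simp only [ha, hdeg, hN]
    push_cast
    ring
  have hS : ∑ x ∈ E, a x ^ 2 ≤ 4 * R ^ 2 * N := by
    have h := conv_bound ψ hψ (Bk ψ) (fun y => if y ∈ E then (1 : ℂ) else 0) _ (Bk_FT (d := d) q hq hodd ψ hψ)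
    simp only [hconv, Complex.norm_real, Real.norm_eq_abs, sq_abs] at h
    have h2 : ∑ x : Fin d → F, ‖(if x ∈ E then (1 : ℂ) else 0)‖ ^ 2 = N := by
      rw [hN, card_eq_sum_ones]
      push_cast
      rw [← univ_inter E, ← sum_ite_mem]
      refine sum_congr rfl fun x _ => ?_
      simp only [univ_inter]
      split_ifs <;> simp
    rw [h2, ← hR2] at h
    exact (sum_le_sum_of_subset_of_nonneg (subset_univ E) fun _ _ _ => sq_nonneg _).trans h
  have hA : ∑ x ∈ E, a x ≤ 2 * R * N := by
    have hcs : (∑ x ∈ E, a x) ^ 2 ≤ N * ∑ x ∈ E, a x ^ 2 := sq_sum_le_card_mul_sum_sq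
    have hN0 : 0 ≤ N := by positivity
    refine abs_le_of_sq_le_sq' ?_ (by positivity) |>.2
    calc _ ≤ N * ∑ x ∈ E, a x ^ 2 := hcs
      _ ≤ N * (4 * R ^ 2 * N) := by gcongr
      _ = _ := by ring
  rw [le_div_iff₀ (by positivity)]
  have hsum : (∑ x ∈ E, (deg x : ℝ) ^ 2) * (q : ℝ) ^ 2 = N ^ 3 + 2 * N * ∑ x ∈ E, a x + ∑ x ∈ E, a x ^ 2 := by
    have h1 : ∀ x ∈ E, (deg x : ℝ) ^ 2 * (q : ℝ) ^ 2 = N ^ 2 + 2 * N * a x + a x ^ 2 := by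
      intro x _; simp only [ha]; ring
    rw [sum_mul, sum_congr rfl h1, sum_add_distrib, sum_add_distrib, ← mul_sum, sum_const, nsmul_eq_mul]
    ring
  rw [hsum]
  have hN0 : 0 ≤ N := by positivity
  have k1 : 2 * N * ∑ x ∈ E, a x ≤ 2 * N * (2 * R * N) := by gcongr
  have k2 : 4 * R ^ 2 * N ≤ 2 * R * N ^ 2 := by
    have : 2 * R * (R * N) ≤ N * (R * N) := by gcongr
    have : 2 * (2 * R * (R * N)) ≤ 2 * (N * (R * N)) := by linarith
    linarith
  linarith
end
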